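/- arXiv:math/0511546 — 10 statements merged into one kernel-verified Lean document; each statement's English description precedes it below -/
import Mathlib

section
/- Let (A, 𝒜) be a Poincaré duality algebra of formal dimension n over the field R, and let r be a positive integer such that 𝒜 i = ⊥ for all i with 0 < i < r. Suppose there exist x ∈ 𝒜 r and a positive integer m with r · m = n and x^m ≠ 0. Then the cup-length equals n/r; precisely: there exist m homogeneous elements of positive degree whose product is nonzero (namely m copies of x), and whenever a_1, …, a_c are homogeneous elements of positive degree with a_1 ⋯ a_c ≠ 0, one has c ≤ m. (Theorem A(a2).) -/
/-- Theorem A(a2): if some `x ∈ 𝒜 r` satisfies `x ^ m ≠ 0` with `r * m = n`, then the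
cup-length of the Poincaré duality algebra equals `m = n / r`: `m` copies of `x` give a
nonzero product of homogeneous elements of positive degree, and no nonzero product of
homogeneous positive-degree elements can be longer than `m`. -/
theorem cupLength_eq_of_height
    {R A : Type*} [Field R] [CommRing A] [Algebra R A]
    (𝒜 : ℕ → Submodule R A) [GradedAlgebra 𝒜] (n : ℕ) (hn : 0 < n)
    (htop : ∀ i, n < i → 𝒜 i = ⊥) (hntop : 𝒜 n ≠ ⊥)
    (hdual : ∀ k, k ≤ n → ∀ x ∈ 𝒜 k, x ≠ 0 → ∃ y ∈ 𝒜 (n - k), x * y ≠ 0)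
    (r : ℕ) (hr : 0 < r) (hgap : ∀ i, 0 < i → i < r → 𝒜 i = ⊥)
    (x : A) (hx : x ∈ 𝒜 r) (m : ℕ) (hm : 0 < m) (hrm : r * m = n)
    (hxm : x ^ m ≠ 0) :
    (∃ (a : Fin m → A) (d : Fin m → ℕ),
        (∀ j, 0 < d j) ∧ (∀ j, a j ∈ 𝒜 (d j)) ∧ (∏ j, a j) ≠ 0) ∧
    (∀ (c : ℕ) (a : Fin c → A) (d : Fin c → ℕ),
        (∀ j, 0 < d j) → (∀ j, a j ∈ 𝒜 (d j)) → (∏ j, a j) ≠ 0 → c ≤ m) := by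
  refine ⟨⟨fun _ => x, fun _ => r, fun _ => hr, fun _ => hx, by simpa using hxm⟩, ?_⟩
  intro c a d hd ha hne
  have hdr : ∀ j, r ≤ d j := by
    intro j
    by_contra h
    have h0 : a j = 0 := by
      have h1 := ha j
      rw [hgap (d j) (hd j) (by omega)] at h1
      simpa using h1
    exact hne (Finset.prod_eq_zero (Finset.mem_univ j) h0)
  have hmem : (∏ j, a j) ∈ 𝒜 (∑ j, d j) :=
    SetLike.prod_mem_graded 𝒜 d a (fun j _ => ha j)
  have hle : ∑ j, d j ≤ n := by
    by_contra h
    rw [htop _ (by omega)] at hmem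
    exact hne (by simpa using hmem)
  have hsum : c * r ≤ ∑ j, d j := by
    have := Finset.card_nsmul_le_sum Finset.univ d r (fun j _ => hdr j)
    simpa using this
  have h2 : r * c ≤ r * m := by
    rw [hrm, mul_comm]
    exact hsum.trans hle
  exact Nat.le_of_mul_le_mul_left h2 hr
end

section
/- Let (A, 𝒜) be a Poincaré duality algebra of formal dimension n over the field R, and let r be a positive integer such that 𝒜 i = ⊥ for all i with 0 < i < r. Suppose a_1, …, a_s ∈ 𝒜 r are nonzero elements and t_1, …, t_s are non-negative integers with T := t_1 + ⋯ + t_s > 0, r · T < n, and a_1^{t_1} ⋯ a_s^{t_s} ≠ 0. Then there exist T + 1 homogeneous elements of A, each of positive degree, whose product is nonzero. (This is the lower bound cup_R(X) ≥ 1 + t_1 + ⋯ + t_s of Theorem A(a3); its proof uses the nonsingularity of the duality pairing.) -/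
/-- Theorem A(a3): if `a 1, …, a s` are nonzero elements of `𝒜 r` with
`a 1 ^ t 1 * ⋯ * a s ^ t s ≠ 0`, where `T = t 1 + ⋯ + t s > 0` and `r * T < n`, then there
is a nonzero product of `T + 1` homogeneous elements of positive degree, i.e. the
cup-length is at least `1 + t 1 + ⋯ + t s`. -/
theorem cupLength_ge_of_products
    {R A : Type*} [Field R] [CommRing A] [Algebra R A]
    (𝒜 : ℕ → Submodule R A) [GradedAlgebra 𝒜] (n : ℕ) (hn : 0 < n)
    (htop : ∀ i, n < i → 𝒜 i = ⊥) (hntop : 𝒜 n ≠ ⊥)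
    (hdual : ∀ k, k ≤ n → ∀ x ∈ 𝒜 k, x ≠ 0 → ∃ y ∈ 𝒜 (n - k), x * y ≠ 0)
    (r : ℕ) (hr : 0 < r) (hgap : ∀ i, 0 < i → i < r → 𝒜 i = ⊥)
    (s : ℕ) (a : Fin s → A) (ha : ∀ j, a j ∈ 𝒜 r) (hane : ∀ j, a j ≠ 0)
    (t : Fin s → ℕ) (hT : 0 < ∑ j, t j) (hrT : r * (∑ j, t j) < n)
    (hprod : (∏ j, a j ^ t j) ≠ 0) :
    ∃ (b : Fin (∑ j, t j + 1) → A) (d : Fin (∑ j, t j + 1) → ℕ),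
      (∀ j, 0 < d j) ∧ (∀ j, b j ∈ 𝒜 (d j)) ∧ (∏ j, b j) ≠ 0 := by
  have hP : (∏ k : Fin (∑ j, t j), a (finSigmaFinEquiv.symm k).1) = ∏ j, a j ^ t j := by
    rw [Equiv.prod_comp (finSigmaFinEquiv (n := t)).symm (fun p => a p.1), Fintype.prod_sigma]
    simp
  have hmem : (∏ k : Fin (∑ j, t j), a (finSigmaFinEquiv.symm k).1) ∈ 𝒜 (r * ∑ j, t j) := by
    have h := SetLike.prod_mem_graded (A := 𝒜) (F := (Finset.univ : Finset (Fin (∑ j, t j))))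
      (i := fun _ => r) (g := fun k => a (finSigmaFinEquiv.symm k).1) (fun k _ => ha _)
    simpa [mul_comm] using h
  obtain ⟨y, hy, hne⟩ := hdual _ hrT.le _ hmem (hP ▸ hprod)
  refine ⟨Fin.snoc (α := fun _ => A) (fun k => a (finSigmaFinEquiv.symm k).1) y,
    Fin.snoc (α := fun _ => ℕ) (fun _ => r) (n - r * ∑ j, t j), ?_, ?_, ?_⟩
  · intro j
    refine Fin.lastCases ?_ (fun k => ?_) j
    · rw [Fin.snoc_last]; omega
    · rw [Fin.snoc_castSucc]; exact hr
  · intro j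
    refine Fin.lastCases ?_ (fun k => ?_) j
    · rw [Fin.snoc_last, Fin.snoc_last]; exact hy
    · rw [Fin.snoc_castSucc, Fin.snoc_castSucc]; exact ha _
  · rw [Fin.prod_univ_castSucc]
    simp only [Fin.snoc_last, Fin.snoc_castSucc]
    exact hne
end

section
/- For all natural numbers κ and m with κ ≤ 2^{m+1} − 2, the weighted-homogeneous component of weighted degree κ (with X of weight 2 and Y of weight 3) of the polynomial (1 + X + Y)^{2^m − 1} ∈ (ZMod 2)[X, Y] equals g_κ = Σ_{i with 2i ≤ κ ≤ 3i} C(i, 3i−κ) X^{3i−κ} Y^{κ−2i}. (This is formula (***) of the paper, computing the generators of the ideal J_{n,3}; it rests on the fact that all binomial coefficients C(2^m − 1, i) are odd.) -/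
open MvPolynomial

/-- `Xp` plays the role of the Stiefel–Whitney class `w₂` (weight 2). -/
noncomputable def Xp : MvPolynomial (Fin 2) (ZMod 2) := X 0

/-- `Yp` plays the role of the Stiefel–Whitney class `w₃` (weight 3). -/
noncomputable def Yp : MvPolynomial (Fin 2) (ZMod 2) := X 1

/-- The polynomial `g κ = Σ_{2i ≤ κ ≤ 3i} C(i, 3i−κ) X^{3i−κ} Y^{κ−2i}` over `ZMod 2`. -/
noncomputable def g (κ : ℕ) : MvPolynomial (Fin 2) (ZMod 2) :=
  ∑ i ∈ Finset.range (κ + 1),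
    if 2 * i ≤ κ ∧ κ ≤ 3 * i then
      (Nat.choose i (3 * i - κ) : ZMod 2) • (Xp ^ (3 * i - κ) * Yp ^ (κ - 2 * i))
    else 0

theorem aux_geom (m : ℕ) (Z : MvPolynomial (Fin 2) (ZMod 2)) (hZ : 1 + Z ≠ 0) :
    (1 + Z) ^ (2 ^ m - 1) = ∑ i ∈ Finset.range (2 ^ m), Z ^ i := by
  apply mul_right_cancel₀ hZ
  have h1 : (2 ^ m - 1) + 1 = 2 ^ m := Nat.sub_add_cancel Nat.one_le_two_pow
  rw [← pow_succ, h1, add_pow_char_pow, one_pow]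
  have h2 := geom_sum_mul Z (2 ^ m)
  rw [CharTwo.sub_eq_add, CharTwo.sub_eq_add] at h2
  rw [add_comm 1 Z, h2, add_comm]

theorem aux_mon (κ a b : ℕ) :
    weightedHomogeneousComponent (![2, 3] : Fin 2 → ℕ) κ (Xp ^ a * Yp ^ b) =
      if κ = 2 * a + 3 * b then Xp ^ a * Yp ^ b else 0 := by
  apply weightedHomogeneousComponent_of_mem
  rw [mem_weightedHomogeneousSubmodule]
  have hX := (isWeightedHomogeneous_X (ZMod 2) (![2, 3] : Fin 2 → ℕ) 0).pow a
  have hY := (isWeightedHomogeneous_X (ZMod 2) (![2, 3] : Fin 2 → ℕ) 1).pow b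
  have := hX.mul hY
  simpa [Xp, Yp, mul_comm] using this

theorem aux_pow (κ i : ℕ) :
    weightedHomogeneousComponent (![2, 3] : Fin 2 → ℕ) κ ((Xp + Yp) ^ i) =
      if 2 * i ≤ κ ∧ κ ≤ 3 * i then
        (Nat.choose i (3 * i - κ) : ZMod 2) • (Xp ^ (3 * i - κ) * Yp ^ (κ - 2 * i))
      else 0 := by
  have e : (Xp + Yp) ^ i = ∑ j ∈ Finset.range (i + 1),
      (Nat.choose i j : ZMod 2) • (Xp ^ j * Yp ^ (i - j)) := by
    rw [add_pow]
    refine Finset.sum_congr rfl fun j _ => ?_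
    rw [Nat.cast_smul_eq_nsmul, nsmul_eq_mul, mul_comm]
  rw [e, map_sum]
  simp only [map_smul, aux_mon]
  split_ifs with h
  · rw [Finset.sum_eq_single (3 * i - κ)]
    · rw [if_pos (by omega)]
      congr 3
      omega
    · intro j hj hne
      rw [Finset.mem_range] at hj
      rw [if_neg (by omega), smul_zero]
    · intro hn
      rw [Finset.mem_range] at hn
      omega
  · refine Finset.sum_eq_zero fun j hj => ?_
    rw [Finset.mem_range] at hj
    rw [if_neg (by omega), smul_zero]

/-- Formula (***): for `κ ≤ 2^(m+1) − 2`, the weighted-homogeneous component of weighted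
degree `κ` (with `X` of weight 2 and `Y` of weight 3) of `(1 + X + Y) ^ (2^m − 1)` over
`ZMod 2` equals `g κ`. -/
theorem weightedComponent_inverse_eq_g (κ m : ℕ) (hκ : κ ≤ 2 ^ (m + 1) - 2) :
    weightedHomogeneousComponent (![2, 3] : Fin 2 → ℕ) κ
      ((1 + Xp + Yp) ^ (2 ^ m - 1)) = g κ := by
  have hne : (1 + (Xp + Yp)) ≠ 0 := by
    intro h
    have := congrArg (eval (fun _ => (0 : ZMod 2))) h
    simp [Xp, Yp] at this
  have h2 : 2 ^ (m + 1) = 2 * 2 ^ m := by ring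
  have h3 : 1 ≤ 2 ^ m := Nat.one_le_two_pow
  rw [add_assoc, aux_geom m _ hne, map_sum, g]
  simp only [aux_pow]
  have key : ∀ N : ℕ, (∀ i, 2 * i ≤ κ → κ ≤ 3 * i → i < N) → N ≤ 2 ^ m + κ + 1 →
      (∑ i ∈ Finset.range N, if 2 * i ≤ κ ∧ κ ≤ 3 * i then
        (Nat.choose i (3 * i - κ) : ZMod 2) • (Xp ^ (3 * i - κ) * Yp ^ (κ - 2 * i)) else 0) =
      ∑ i ∈ Finset.range (2 ^ m + κ + 1), if 2 * i ≤ κ ∧ κ ≤ 3 * i then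
        (Nat.choose i (3 * i - κ) : ZMod 2) • (Xp ^ (3 * i - κ) * Yp ^ (κ - 2 * i)) else 0 := by
    intro N hN hle
    apply Finset.sum_subset (Finset.range_mono hle)
    intro i _ hi
    rw [if_neg]
    rintro ⟨ha, hb⟩
    exact hi (Finset.mem_range.2 (hN i ha hb))
  rw [key (2 ^ m) (by intros; omega) (by omega), key (κ + 1) (by intros; omega) (by omega)]
end

section
/- In (ZMod 2)[X, Y] one has g_4 = X², g_5 = 0, and g_6 = Y² + X³, and the monomial X·Y does not belong to the ideal generated by g_4, g_5, g_6, i.e. X·Y ∉ Ideal.span {X², Y² + X³}. (This is the computation in the proof of Proposition B(a), showing w̃_2 w̃_3 ≠ 0 in H*(G̃_{6,3}; Z2) and hence cup(G̃_{6,3}) ≥ 3.) -/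
open MvPolynomial

/-- Proposition B(a): `g 4 = X²`, `g 5 = 0`, `g 6 = Y² + X³`, and `X·Y` is not in the
ideal `(X², Y² + X³)`, i.e. `w̃₂ w̃₃ ≠ 0` in `H*(G̃₆,₃; Z₂)`. -/
theorem xy_not_mem_span_G63 :
    g 4 = Xp ^ 2 ∧ g 5 = 0 ∧ g 6 = Yp ^ 2 + Xp ^ 3 ∧
    Xp * Yp ∉ Ideal.span ({Xp ^ 2, Yp ^ 2 + Xp ^ 3} :
      Set (MvPolynomial (Fin 2) (ZMod 2))) := by
  refine ⟨?_, ?_, ?_, ?_⟩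
  · simp [g, Finset.sum_range_succ, Nat.choose]
  · have h : (2 : ZMod 2) = 0 := by decide
    simp [g, Finset.sum_range_succ, Nat.choose, h]
  · have h : (3 : ZMod 2) = 1 := by decide
    simp [g, Finset.sum_range_succ, Nat.choose, h, add_comm]
  · intro hmem
    let a : DualNumber (DualNumber (ZMod 2)) := TrivSqZeroExt.inl DualNumber.eps
    let b : DualNumber (DualNumber (ZMod 2)) := DualNumber.eps
    have ha : a ^ 2 = 0 := by
      rw [pow_two, ← TrivSqZeroExt.inl_mul, DualNumber.eps_mul_eps, TrivSqZeroExt.inl_zero]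
    have hb : b ^ 2 = 0 := by
      rw [pow_two]
      exact DualNumber.eps_mul_eps
    let f : MvPolynomial (Fin 2) (ZMod 2) →ₐ[ZMod 2] DualNumber (DualNumber (ZMod 2)) :=
      aeval ![a, b]
    have hX : f Xp = a := by simp [f, Xp]
    have hY : f Yp = b := by simp [f, Yp]
    have hle : Ideal.span ({Xp ^ 2, Yp ^ 2 + Xp ^ 3} :
        Set (MvPolynomial (Fin 2) (ZMod 2))) ≤ RingHom.ker f := by
      rw [Ideal.span_le]
      rintro p (rfl | rfl)
      · simp [RingHom.mem_ker, hX, ha]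
      · simp [RingHom.mem_ker, hX, hY, hb, pow_succ a 2, ha]
    have h0 : a * b = 0 := by
      have h := hle hmem
      rwa [RingHom.mem_ker, map_mul, hX, hY] at h
    have h1 := congrArg (fun z => TrivSqZeroExt.snd (TrivSqZeroExt.snd z)) h0
    simp [a, b] at h1
end

section
/- In (ZMod 2)[X, Y] one has g_7 = X²·Y, g_8 = X·Y² + X⁴, and g_9 = Y³, and X⁴ does not belong to the ideal generated by g_7, g_8, g_9, i.e. X⁴ ∉ Ideal.span {X²·Y, X·Y² + X⁴, Y³}. (This is the computation in the proof of Proposition B(c) for n = 9, showing w̃_2⁴ ≠ 0 in H*(G̃_{9,3}; Z2).) -/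
open MvPolynomial

/-- Proposition B(c), case `n = 9`: `g 7 = X²Y`, `g 8 = XY² + X⁴`, `g 9 = Y³`, and `X⁴`
is not in the ideal `(X²Y, XY² + X⁴, Y³)`, i.e. `w̃₂⁴ ≠ 0` in `H*(G̃₉,₃; Z₂)`. -/
theorem x4_not_mem_span_G93 :
    g 7 = Xp ^ 2 * Yp ∧ g 8 = Xp * Yp ^ 2 + Xp ^ 4 ∧ g 9 = Yp ^ 3 ∧
    Xp ^ 4 ∉ Ideal.span ({Xp ^ 2 * Yp, Xp * Yp ^ 2 + Xp ^ 4, Yp ^ 3} :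
      Set (MvPolynomial (Fin 2) (ZMod 2))) := by
  refine ⟨?_, ?_, ?_, ?_⟩
  · skip
    simp [g, Finset.sum_range_succ]
    rw [show (3 : ZMod 2) = 1 by decide, one_smul]
  · simp [g, Finset.sum_range_succ]
    rw [show (3 : ZMod 2) = 1 by decide, one_smul]
  · simp [g, Finset.sum_range_succ]
    exact Or.inl (by decide)
  · intro h
    have e1 : Xp ^ 2 * Yp = monomial (Finsupp.single 0 2 + Finsupp.single 1 1) 1 := by
      simp [Xp, Yp, X, monomial_pow, monomial_mul]
    have e2 : Xp * Yp ^ 2 = monomial (Finsupp.single 0 1 + Finsupp.single 1 2) 1 := by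
      simp [Xp, Yp, X, monomial_pow, monomial_mul]
    have e3 : Xp ^ 4 = monomial (Finsupp.single 0 4) 1 := by
      simp [Xp, X, monomial_pow]
    have e4 : Yp ^ 3 = monomial (Finsupp.single 1 3) 1 := by
      simp [Yp, X, monomial_pow]
    rw [e1, e2, e3, e4] at h
    simp only [Ideal.mem_span_insert, Ideal.mem_span_singleton'] at h
    obtain ⟨a, z, ⟨b, w, ⟨c, rfl⟩, rfl⟩, h⟩ := h
    have h1 := congrArg (coeff (Finsupp.single 0 4)) h
    have h2 := congrArg (coeff (Finsupp.single 0 1 + Finsupp.single 1 2)) h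
    simp [mul_add, coeff_mul_monomial', coeff_monomial, Finsupp.le_def, Fin.forall_fin_two,
      Finsupp.ext_iff] at h1 h2
    rw [← h2] at h1
    exact one_ne_zero h1
end

section
/- For every odd integer n ≥ 7 with n ∉ {9, 11}, the monomial X^{(n+1)/2} does not belong to the ideal of (ZMod 2)[X, Y] generated by g_{n−2}, g_{n−1}, g_n, i.e. X^{(n+1)/2} ∉ Ideal.span {g_{n−2}, g_{n−1}, g_n}. (This is the key lemma in the proof of Proposition B(b): n + 1 is an 'available target dimension', so w̃_2^{(n+1)/2} ≠ 0 in H*(G̃_{n,3}; Z2).) -/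
open MvPolynomial

noncomputable def mon (x y : ℕ) : Fin 2 →₀ ℕ := Finsupp.single 0 x + Finsupp.single 1 y

lemma mon_zero (x y : ℕ) : mon x y 0 = x := by simp [mon]
lemma mon_one (x y : ℕ) : mon x y 1 = y := by simp [mon]

lemma eq_mon (d : Fin 2 →₀ ℕ) : d = mon (d 0) (d 1) := by
  ext i
  fin_cases i
  · simp [mon_zero]
  · simp [mon_one]

lemma mon_inj {x y x' y' : ℕ} : mon x y = mon x' y' ↔ x = x' ∧ y = y' := by
  constructor
  · intro h
    have h0 := DFunLike.congr_fun h 0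
    have h1 := DFunLike.congr_fun h 1
    rw [mon_zero, mon_zero] at h0
    rw [mon_one, mon_one] at h1
    exact ⟨h0, h1⟩
  · rintro ⟨rfl, rfl⟩; rfl

lemma XY_eq (x y : ℕ) : Xp ^ x * Yp ^ y = monomial (mon x y) (1 : ZMod 2) := by
  simp [Xp, Yp, X_pow_eq_monomial, monomial_mul, mon]

lemma coeff_g (κ x y : ℕ) : coeff (mon x y) (g κ) =
    if 2 * x + 3 * y = κ then (Nat.choose (x + y) x : ZMod 2) else 0 := by
  classical
  unfold g
  rw [coeff_sum]
  have key : ∀ i ∈ Finset.range (κ + 1), coeff (mon x y) (if 2 * i ≤ κ ∧ κ ≤ 3 * i then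
      (Nat.choose i (3 * i - κ) : ZMod 2) • (Xp ^ (3 * i - κ) * Yp ^ (κ - 2 * i))
    else 0) = if i = x + y then
      (if 2 * x + 3 * y = κ then (Nat.choose (x + y) x : ZMod 2) else 0) else 0 := by
    intro i _
    by_cases h : 2 * i ≤ κ ∧ κ ≤ 3 * i
    · rw [if_pos h, XY_eq, coeff_smul, coeff_monomial]
      simp only [mon_inj]
      by_cases h2 : 3 * i - κ = x ∧ κ - 2 * i = y
      · have e1 : i = x + y := by omega
        have e2 : 2 * x + 3 * y = κ := by omega
        rw [if_pos h2, if_pos e1, if_pos e2, h2.1, e1]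
        simp
      · rw [if_neg h2]
        by_cases e1 : i = x + y
        · rw [if_pos e1, if_neg (by omega)]; simp
        · rw [if_neg e1]; simp
    · rw [if_neg h]
      by_cases e1 : i = x + y
      · rw [if_pos e1, if_neg (by omega)]; simp
      · rw [if_neg e1]; simp
  rw [Finset.sum_congr rfl key, Finset.sum_ite_eq']
  by_cases e2 : 2 * x + 3 * y = κ
  · rw [if_pos (by simp; omega)]
  · simp [e2]

lemma coeff_mul_zero (a : MvPolynomial (Fin 2) (ZMod 2)) (κ x y : ℕ)
    (h : ∀ u v : ℕ, 2 * u + 3 * v + κ = 2 * x + 3 * y → coeff (mon u v) a = 0) :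
    coeff (mon x y) (a * g κ) = 0 := by
  classical
  rw [coeff_mul]
  apply Finset.sum_eq_zero
  rintro ⟨u, v⟩ huv
  rw [Finset.HasAntidiagonal.mem_antidiagonal] at huv
  have h0 := DFunLike.congr_fun huv 0
  have h1 := DFunLike.congr_fun huv 1
  simp only [Finsupp.add_apply, mon_zero, mon_one] at h0 h1
  show coeff u a * coeff v (g κ) = 0
  rw [eq_mon u, eq_mon v, coeff_g]
  by_cases e : 2 * v 0 + 3 * v 1 = κ
  · rw [h (u 0) (u 1) (by omega), zero_mul]
  · rw [if_neg e, mul_zero]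

lemma coeff_mon_mul (s t κ x y : ℕ) :
    coeff (mon (s + x) (t + y)) (monomial (mon s t) (1 : ZMod 2) * g κ) = coeff (mon x y) (g κ) := by
  have : mon (s + x) (t + y) = mon s t + mon x y := by
    simp only [mon, Finsupp.single_add]; abel
  rw [this, coeff_monomial_mul, one_mul]

lemma coeff_mul_g (a : MvPolynomial (Fin 2) (ZMod 2)) (s t κ x y : ℕ)
    (h : ∀ u v : ℕ, 2 * u + 3 * v + κ = 2 * x + 3 * y → u = s ∧ v = t) :
    coeff (mon x y) (a * g κ) =
      coeff (mon s t) a * coeff (mon x y) (monomial (mon s t) (1 : ZMod 2) * g κ) := by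
  have := coeff_mul_zero (a - C (coeff (mon s t) a) * monomial (mon s t) (1 : ZMod 2)) κ x y (by
    intro u v huv
    obtain ⟨rfl, rfl⟩ := h u v huv
    simp)
  rw [sub_mul, coeff_sub, sub_eq_zero, mul_assoc, coeff_C_mul] at this
  exact this

lemma coeff_Y_mul_zero (κ x : ℕ) :
    coeff (mon x 0) (monomial (mon 0 1) (1 : ZMod 2) * g κ) = 0 := by
  classical
  rw [coeff_monomial_mul', if_neg]
  intro h
  have := h 1
  simp [mon_one] at this

lemma coeff_X_mul_zero (κ y : ℕ) :
    coeff (mon 0 y) (monomial (mon 1 0) (1 : ZMod 2) * g κ) = 0 := by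
  classical
  rw [coeff_monomial_mul', if_neg]
  intro h
  have := h 0
  simp [mon_zero] at this

lemma choose_two_odd (k : ℕ) (h : k % 4 = 2 ∨ k % 4 = 3) : Nat.choose k 2 % 2 = 1 := by
  have : Fact (Nat.Prime 2) := ⟨Nat.prime_two⟩
  have := Choose.choose_modEq_choose_mod_mul_choose_div_nat (p := 2) (n := k) (k := 2)
  rw [Nat.ModEq] at this
  rw [this]
  have : k / 2 % 2 = 1 := by omega
  simp [this]

lemma choose_half (a b : ℕ) : Nat.choose a (2 * b) % 2 = Nat.choose (a / 2) b % 2 := by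
  have : Fact (Nat.Prime 2) := ⟨Nat.prime_two⟩
  have := Choose.choose_modEq_choose_mod_mul_choose_div_nat (p := 2) (n := a) (k := 2 * b)
  rw [Nat.ModEq] at this
  rw [this]
  simp

lemma exists_j (k : ℕ) (hk : 3 ≤ k) (h5 : k ≠ 5) :
    ∃ j, 1 ≤ j ∧ 3 * j ≤ k ∧ Nat.choose (k - j) (2 * j) % 2 = 1 := by
  induction k using Nat.strong_induction_on with
  | _ k ih =>
    by_cases h03 : k % 4 = 0 ∨ k % 4 = 3
    · exact ⟨1, le_rfl, by omega, choose_two_odd _ (by omega)⟩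
    by_cases h10 : k = 10
    · subst h10; exact ⟨3, by decide, by decide, by decide⟩
    obtain ⟨j, h1, h2, h3⟩ := ih (k / 2) (by omega) (by omega) (by omega)
    refine ⟨2 * j, by omega, by omega, ?_⟩
    rw [choose_half]
    have : (k - 2 * j) / 2 = k / 2 - j := by omega
    rw [this, h3]

lemma cast_one (a : ℕ) (h : a % 2 = 1) : (a : ZMod 2) = 1 := by
  rw [← ZMod.natCast_mod, h]; simp

/-- The key lemma for Proposition B(b): for odd `n ≥ 7` with `n ∉ {9, 11}`, the monomial
`X^((n+1)/2)` is not in the ideal `(g (n−2), g (n−1), g n)`; hence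
`w̃₂^((n+1)/2) ≠ 0` in `H*(G̃ₙ,₃; Z₂)`. -/
theorem x_pow_not_mem_span_odd (n : ℕ) (hn : 7 ≤ n) (hodd : Odd n)
    (h9 : n ≠ 9) (h11 : n ≠ 11) :
    Xp ^ ((n + 1) / 2) ∉ Ideal.span ({g (n - 2), g (n - 1), g n} :
      Set (MvPolynomial (Fin 2) (ZMod 2))) := by
  intro hmem
  obtain ⟨k, rfl⟩ := hodd
  have e1 : (2 * k + 1 + 1) / 2 = k + 1 := by omega
  have e2 : 2 * k + 1 - 1 = 2 * k := by omega
  rw [e1, e2, Ideal.mem_span_insert] at hmem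
  obtain ⟨a, z, hz, hX⟩ := hmem
  rw [Ideal.mem_span_pair] at hz
  obtain ⟨b, c, rfl⟩ := hz
  have hX' : monomial (mon (k + 1) 0) (1 : ZMod 2) =
      a * g (2 * k + 1 - 2) + (b * g (2 * k) + c * g (2 * k + 1)) := by
    rw [← hX, ← XY_eq]; simp
  -- coefficients in weight `2k+2`
  have key : ∀ x y : ℕ, 2 * x + 3 * y = 2 * k + 2 →
      coeff (mon x y) (monomial (mon (k + 1) 0) (1 : ZMod 2)) =
      coeff (mon 0 1) a * coeff (mon x y) (monomial (mon 0 1) (1 : ZMod 2) * g (2 * k + 1 - 2)) +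
      coeff (mon 1 0) b * coeff (mon x y) (monomial (mon 1 0) (1 : ZMod 2) * g (2 * k)) := by
    intro x y hxy
    rw [hX', coeff_add, coeff_add, coeff_mul_g a 0 1 _ x y (by omega),
      coeff_mul_g b 1 0 _ x y (by omega), coeff_mul_zero c _ x y (by omega), add_zero]
  have hb : coeff (mon 1 0) b = 1 := by
    have h := key (k + 1) 0 (by omega)
    have h2 := coeff_mon_mul 1 0 (2 * k) k 0
    rw [coeff_g, add_zero] at h2
    rw [coeff_Y_mul_zero, add_comm k 1, h2] at h
    simpa using h.symm
  have hne : ∀ x y : ℕ, y ≠ 0 → coeff (mon x y) (monomial (mon (k + 1) 0) (1 : ZMod 2)) = 0 := by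
    intro x y hy
    classical
    rw [coeff_monomial, if_neg]
    rw [mon_inj]; omega
  have ha : coeff (mon 0 1) a = 0 ∨ coeff (mon 0 1) a = 1 := by
    generalize coeff (mon 0 1) a = q
    revert q; decide
  rcases ha with ha | ha
  · obtain ⟨j, h1, h2, h3⟩ := exists_j k (by omega) (by omega)
    have h := key (1 + (k - 3 * j)) (0 + 2 * j) (by omega)
    rw [hne _ _ (by omega), ha, hb, coeff_mon_mul, coeff_g, if_pos (by omega)] at h
    have e : k - 3 * j + 2 * j = k - j := by omega
    rw [e, ← Nat.choose_symm (by omega)] at h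
    have e' : k - j - (k - 3 * j) = 2 * j := by omega
    rw [e', cast_one _ h3] at h
    simp at h
  · obtain ⟨j, h1, h2, h3⟩ := exists_j (k + 1) (by omega) (by omega)
    obtain ⟨i, rfl⟩ : ∃ i, j = i + 1 := ⟨j - 1, by omega⟩
    have hY := coeff_mon_mul 0 1 (2 * k + 1 - 2) (k + 1 - 3 * (i + 1)) (2 * i + 1)
    rw [coeff_g, if_pos (by omega)] at hY
    have h := key (0 + (k + 1 - 3 * (i + 1))) (1 + (2 * i + 1)) (by omega)
    rw [hne _ _ (by omega), ha, hb, hY, one_mul, one_mul] at h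
    rcases Nat.eq_zero_or_pos (k + 1 - 3 * (i + 1)) with hx | hx
    · rw [hx, add_zero, coeff_X_mul_zero] at h
      simp at h
    · obtain ⟨x, hx'⟩ : ∃ x, k + 1 - 3 * (i + 1) = x + 1 := ⟨k + 1 - 3 * (i + 1) - 1, by omega⟩
      have hXc := coeff_mon_mul 1 0 (2 * k) x (2 * i + 2)
      rw [coeff_g, if_pos (by omega)] at hXc
      have e3 : mon (0 + (k + 1 - 3 * (i + 1))) (1 + (2 * i + 1)) = mon (1 + x) (0 + (2 * i + 2)) := by
        rw [mon_inj]; omega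
      rw [e3, hXc, hx', ← Nat.cast_add] at h
      have e4 : Nat.choose (x + 1 + (2 * i + 1)) (x + 1) + Nat.choose (x + (2 * i + 2)) x
          = Nat.choose (k + 1 - (i + 1)) (2 * (i + 1)) := by
        have e5 : k + 1 - (i + 1) = (x + (2 * i + 2)) + 1 := by omega
        have e6 : x + 1 + (2 * i + 1) = x + (2 * i + 2) := by omega
        rw [e6, add_comm, ← Nat.choose_succ_succ, e5]
        rw [← Nat.choose_symm (by omega)]
        congr 1
        omega
      rw [e4, cast_one _ h3] at h
      simp at h
end

section
/- For every integer t ≥ 2, setting n = 6t + 5, the monomial X^{3t+3} does not belong to the ideal of (ZMod 2)[X, Y] generated by g_{6t+3}, g_{6t+4}, g_{6t+5}, i.e. X^{3t+3} ∉ Ideal.span {g_{6t+3}, g_{6t+4}, g_{6t+5}}. (Case n ≡ 5 mod 6, n ≠ 11, in the proof of Proposition B(b).) -/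
open MvPolynomial

lemma aux_eq (m : Fin 2 →₀ ℕ) (a b : ℕ) :
    (Finsupp.single 0 a + Finsupp.single 1 b = m) ↔ (a = m 0 ∧ b = m 1) := by
  constructor
  · rintro rfl
    simp
  · rintro ⟨rfl, rfl⟩
    ext i
    fin_cases i <;> simp

lemma aux_mon_s12 (a b : ℕ) : Xp ^ a * Yp ^ b =
    monomial (Finsupp.single 0 a + Finsupp.single 1 b) (1 : ZMod 2) := by
  rw [Xp, Yp, X_pow_eq_monomial, X_pow_eq_monomial, monomial_mul, one_mul]

lemma aux_coeff (κ : ℕ) (m : Fin 2 →₀ ℕ) :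
    coeff m (g κ) = if 2 * m 0 + 3 * m 1 = κ then (Nat.choose (m 0 + m 1) (m 0) : ZMod 2) else 0 := by
  have h : ∀ i, coeff m (if 2 * i ≤ κ ∧ κ ≤ 3 * i then
      (Nat.choose i (3 * i - κ) : ZMod 2) • (Xp ^ (3 * i - κ) * Yp ^ (κ - 2 * i))
    else 0) = if i = m 0 + m 1 then
      (if 2 * m 0 + 3 * m 1 = κ then (Nat.choose (m 0 + m 1) (m 0) : ZMod 2) else 0) else 0 := by
    intro i
    by_cases h1 : 2 * i ≤ κ ∧ κ ≤ 3 * i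
    · rw [if_pos h1, aux_mon_s12, coeff_smul, coeff_monomial]
      simp only [aux_eq]
      by_cases h2 : 3 * i - κ = m 0 ∧ κ - 2 * i = m 1
      · have h3 : i = m 0 + m 1 := by omega
        have h4 : 2 * m 0 + 3 * m 1 = κ := by omega
        rw [if_pos h2, if_pos h3, if_pos h4, h2.1, h3]
        simp
      · rw [if_neg h2]
        by_cases h3 : i = m 0 + m 1
        · rw [if_pos h3, if_neg (by omega)]
          simp
        · rw [if_neg h3]
          simp
    · rw [if_neg h1, coeff_zero]
      by_cases h3 : i = m 0 + m 1
      · rw [if_pos h3, if_neg (by omega)]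
      · rw [if_neg h3]
  rw [g, coeff_sum, Finset.sum_congr rfl (fun i _ => h i), Finset.sum_ite_eq']
  by_cases h4 : 2 * m 0 + 3 * m 1 = κ
  · rw [if_pos (by simp; omega)]
  · simp [h4]

/-- Only one monomial `s` of weight `w` : coefficient of a product. -/
lemma aux_mul (κ w : ℕ) (s m : Fin 2 →₀ ℕ) (hm : 2 * m 0 + 3 * m 1 = κ + w)
    (hs : ∀ u : Fin 2 →₀ ℕ, 2 * u 0 + 3 * u 1 = w → u = s)
    (p : MvPolynomial (Fin 2) (ZMod 2)) :
    coeff m (p * g κ) = coeff s p * (if s ≤ m then coeff (m - s) (g κ) else 0) := by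
  induction p using MvPolynomial.induction_on' with
  | monomial u c =>
    rw [coeff_monomial_mul', coeff_monomial]
    by_cases h : u = s
    · subst h
      simp
    · rw [if_neg h, zero_mul]
      split_ifs with hu
      · rw [aux_coeff, if_neg, mul_zero]
        intro h2
        apply h
        apply hs
        have h0 := hu 0
        have h1 := hu 1
        simp only [Finsupp.coe_tsub, Pi.sub_apply] at h2
        omega
      · rfl
  | add p q hp hq => rw [add_mul, coeff_add, coeff_add, hp, hq, add_mul]

lemma aux_mul_none (κ : ℕ) (m : Fin 2 →₀ ℕ) (hm : 2 * m 0 + 3 * m 1 = κ + 1)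
    (p : MvPolynomial (Fin 2) (ZMod 2)) :
    coeff m (p * g κ) = 0 := by
  induction p using MvPolynomial.induction_on' with
  | monomial u c =>
    rw [coeff_monomial_mul']
    split_ifs with hu
    · rw [aux_coeff, if_neg, mul_zero]
      intro h2
      have h0 := hu 0
      have h1 := hu 1
      simp only [Finsupp.coe_tsub, Pi.sub_apply] at h2
      omega
    · rfl
  | add p q hp hq => rw [add_mul, coeff_add, hp, hq, add_zero]

lemma aux_le (a b c d : ℕ) : ((Finsupp.single 0 a + Finsupp.single 1 b : Fin 2 →₀ ℕ) ≤
    Finsupp.single 0 c + Finsupp.single 1 d) ↔ (a ≤ c ∧ b ≤ d) := by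
  constructor
  · intro h
    have h0 := h 0
    have h1 := h 1
    simp at h0 h1
    exact ⟨h0, h1⟩
  · rintro ⟨h0, h1⟩ i
    fin_cases i <;> simpa

/-- Linear relation among coefficients in weight `6t+6`. -/
lemma aux_rel (t : ℕ) (h : Xp ^ (3 * t + 3) ∈
    Ideal.span ({g (6 * t + 3), g (6 * t + 4), g (6 * t + 5)} :
      Set (MvPolynomial (Fin 2) (ZMod 2)))) :
    ∃ α β : ZMod 2, ∀ a b : ℕ, 2 * a + 3 * b = 6 * t + 6 →
      (if b = 0 then (1 : ZMod 2) else 0) =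
        β * (if 1 ≤ b then (Nat.choose (a + (b - 1)) a : ZMod 2) else 0) +
        α * (if 1 ≤ a then (Nat.choose (a - 1 + b) (a - 1) : ZMod 2) else 0) := by
  rw [Ideal.mem_span_insert] at h
  obtain ⟨p, z, hz, h⟩ := h
  rw [Ideal.mem_span_pair] at hz
  obtain ⟨q, r, rfl⟩ := hz
  refine ⟨coeff (Finsupp.single 0 1 + Finsupp.single 1 0) q,
    coeff (Finsupp.single 0 0 + Finsupp.single 1 1) p, fun a b hab => ?_⟩
  have h2 := congrArg (coeff (Finsupp.single 0 a + Finsupp.single 1 b)) h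
  rw [coeff_add, coeff_add,
    aux_mul (6 * t + 3) 3 (Finsupp.single 0 0 + Finsupp.single 1 1) _ (by simp; omega)
      (fun u hu => ((aux_eq u 0 1).2 (by omega)).symm),
    aux_mul (6 * t + 4) 2 (Finsupp.single 0 1 + Finsupp.single 1 0) _ (by simp; omega)
      (fun u hu => ((aux_eq u 1 0).2 (by omega)).symm),
    aux_mul_none (6 * t + 5) _ (by simp; omega), add_zero, aux_coeff, aux_coeff] at h2
  have h3 : Xp ^ (3 * t + 3) = Xp ^ (3 * t + 3) * Yp ^ 0 := by simp
  rw [h3, aux_mon_s12, coeff_monomial] at h2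
  simp only [aux_eq, aux_le] at h2
  have e1 : (if b = 0 then (1 : ZMod 2) else 0) =
      if 3 * t + 3 = (Finsupp.single 0 a + Finsupp.single 1 b : Fin 2 →₀ ℕ) 0 ∧
        0 = (Finsupp.single 0 a + Finsupp.single 1 b : Fin 2 →₀ ℕ) 1 then (1 : ZMod 2) else 0 := by
    congr 1
    simp
    omega
  rw [e1, h2]
  congr 2
  · by_cases hb : 1 ≤ b
    · simp [hb]
      omega
    · simp [hb]
  · by_cases ha : 1 ≤ a
    · simp [ha]
      omega
    · simp [ha]

lemma aux_choose (n k : ℕ) : (Nat.choose n k : ZMod 2) =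
    (Nat.choose (n % 2) (k % 2) : ZMod 2) * (Nat.choose (n / 2) (k / 2) : ZMod 2) := by
  have : Fact (Nat.Prime 2) := ⟨Nat.prime_two⟩
  have := (ZMod.natCast_eq_natCast_iff _ _ _).2
    (Choose.choose_modEq_choose_mod_mul_choose_div_nat (n := n) (k := k) (p := 2))
  simpa using this

/-- Proposition B(b), case `n = 6t + 5` with `t ≥ 2`: `X^(3t+3)` is not in the ideal
`(g (6t+3), g (6t+4), g (6t+5))`. -/
theorem x_pow_not_mem_span_6t5 (t : ℕ) (ht : 2 ≤ t) :
    Xp ^ (3 * t + 3) ∉ Ideal.span ({g (6 * t + 3), g (6 * t + 4), g (6 * t + 5)} :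
      Set (MvPolynomial (Fin 2) (ZMod 2))) := by
  intro h
  obtain ⟨α, β, h⟩ := aux_rel t h
  have hα := h (3 * t + 3) 0 (by omega)
  have hβ := h 0 (2 * t + 2) (by omega)
  simp at hα hβ
  subst hα hβ
  have key : ∀ j, 1 ≤ j → j ≤ t → (Nat.choose (3 * t + 2 - j) (2 * j) : ZMod 2) = 0 := by
    intro j h1 h2
    have h3 := h (3 * (t + 1 - j)) (2 * j) (by omega)
    rw [if_neg (by omega), if_pos (by omega : 1 ≤ 3 * (t + 1 - j)), zero_mul, zero_add, one_mul,
      Nat.choose_symm_add] at h3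
    rw [h3]
    congr 2
    omega
  have h01 : (1 : ZMod 2) ≠ 0 := by decide
  apply h01
  have h4 : t % 2 = 0 ∨ t % 4 = 3 ∨ t % 4 = 1 := by omega
  rcases h4 with h4 | h4 | h4
  · have := key t (by omega) le_rfl
    obtain ⟨k, rfl⟩ : ∃ k, t = 2 * k := ⟨t / 2, by omega⟩
    rw [Nat.choose_symm_of_eq_add (b := 2) (by omega), aux_choose,
      show (3 * (2 * k) + 2 - 2 * k) % 2 = 0 by omega,
      show (3 * (2 * k) + 2 - 2 * k) / 2 = 2 * k + 1 by omega] at this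
    rw [← this]
    have h2 : (2 : ZMod 2) = 0 := by decide
    simp [h2]
  · have := key 1 (by omega) (by omega)
    obtain ⟨k, rfl⟩ : ∃ k, t = 4 * k + 3 := ⟨t / 4, by omega⟩
    rw [aux_choose,
      show (3 * (4 * k + 3) + 2 - 1) % 2 = 0 by omega,
      show (3 * (4 * k + 3) + 2 - 1) / 2 = 2 * (3 * k + 2) + 1 by omega] at this
    rw [← this]
    have h2 : (2 : ZMod 2) = 0 := by decide
    simp [h2]
  · have := key (t - 1) (by omega) (by omega)
    obtain ⟨k, rfl⟩ : ∃ k, t = 4 * k + 1 := ⟨t / 4, by omega⟩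
    rw [Nat.choose_symm_of_eq_add (b := 5) (by omega), aux_choose,
      show (3 * (4 * k + 1) + 2 - (4 * k + 1 - 1)) % 2 = 1 by omega,
      show (3 * (4 * k + 1) + 2 - (4 * k + 1 - 1)) / 2 = 4 * k + 2 by omega,
      aux_choose (4 * k + 2), show (4 * k + 2) % 2 = 0 by omega,
      show (4 * k + 2) / 2 = 2 * k + 1 by omega] at this
    rw [← this]
    have h2 : (2 : ZMod 2) = 0 := by decide
    simp [h2]
end

section
/- For every integer t ≥ 1 one has the identity in (ZMod 2)[X, Y]: X·g_{6t+2} + Y·g_{6t+1} = Σ_{i=2t+1}^{3t} C(i+1, 3i−6t−1) · X^{3i−6t−1} · Y^{6t+2−2i} + X^{3t+2}, where the binomial coefficients are reduced mod 2. (This is the displayed computation of w_2 g_{n−1} + w_3 g_{n−2} for n = 6t+3 in the proof of Proposition B(b).) -/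
open MvPolynomial

theorem g_eq_Icc (κ a b : ℕ) (ha : ∀ i, κ ≤ 3 * i ↔ a ≤ i) (hb : ∀ i, 2 * i ≤ κ ↔ i ≤ b) :
    g κ = ∑ i ∈ Finset.Icc a b,
      (Nat.choose i (3 * i - κ) : ZMod 2) • (Xp ^ (3 * i - κ) * Yp ^ (κ - 2 * i)) := by
  unfold g
  rw [← Finset.sum_filter]
  apply Finset.sum_congr
  · ext i
    have h1 := ha i
    have h2 := hb i
    simp only [Finset.mem_filter, Finset.mem_range, Finset.mem_Icc]
    omega
  · intros; rfl

/-- The displayed computation of `w₂ g (n−1) + w₃ g (n−2)` for `n = 6t + 3` in the proof of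
Proposition B(b): `X·g (6t+2) + Y·g (6t+1)` equals
`Σ_{i=2t+1}^{3t} C(i+1, 3i−6t−1) X^(3i−6t−1) Y^(6t+2−2i) + X^(3t+2)` over `ZMod 2`. -/
theorem x_g_add_y_g_eq (t : ℕ) (ht : 1 ≤ t) :
    Xp * g (6 * t + 2) + Yp * g (6 * t + 1) =
      (∑ i ∈ Finset.Icc (2 * t + 1) (3 * t),
        (Nat.choose (i + 1) (3 * i - (6 * t + 1)) : ZMod 2) •
          (Xp ^ (3 * i - (6 * t + 1)) * Yp ^ (6 * t + 2 - 2 * i)))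
      + Xp ^ (3 * t + 2) := by
  rw [g_eq_Icc (6 * t + 2) (2 * t + 1) (3 * t + 1) (by intro i; omega) (by intro i; omega),
    g_eq_Icc (6 * t + 1) (2 * t + 1) (3 * t) (by intro i; omega) (by intro i; omega),
    Finset.sum_Icc_succ_top (by omega), mul_add, add_right_comm, Finset.mul_sum, Finset.mul_sum,
    ← Finset.sum_add_distrib]
  congr 1
  · apply Finset.sum_congr rfl
    intro i hi
    rw [Finset.mem_Icc] at hi
    obtain ⟨k, hk⟩ : ∃ k, 3 * i = 6 * t + 2 + k := ⟨3 * i - (6 * t + 2), by omega⟩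
    obtain ⟨m, hm⟩ : ∃ m, 6 * t + 1 = 2 * i + m := ⟨6 * t + 1 - 2 * i, by omega⟩
    have e1 : 3 * i - (6 * t + 2) = k := by omega
    have e2 : 3 * i - (6 * t + 1) = k + 1 := by omega
    have e3 : 6 * t + 2 - 2 * i = m + 1 := by omega
    have e4 : 6 * t + 1 - 2 * i = m := by omega
    rw [e1, e2, e3, e4, Nat.choose_succ_succ, Nat.cast_add, add_smul, mul_smul_comm,
      mul_smul_comm]
    congr 2 <;> ring
  · have e1 : 3 * (3 * t + 1) - (6 * t + 2) = 3 * t + 1 := by omega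
    have e2 : 6 * t + 2 - 2 * (3 * t + 1) = 0 := by omega
    rw [e1, e2, Nat.choose_self]
    simp only [Nat.cast_one, one_smul, pow_zero, mul_one]
    ring
end

section
/- For every integer t ≥ 1: the coefficient of the monomial X·Y^{2t} in X·g_{6t} ∈ (ZMod 2)[X, Y] equals 1; the coefficient of X·Y^{2t} in Y·g_{6t−1} equals 0; and the coefficient of X^{3t+1} in X·g_{6t} equals 1. Consequently the coefficient of X·Y^{2t} in X·g_{6t} + Y·g_{6t−1} equals 1. (These are the displayed computations of w_2 g_{n−1} and w_3 g_{n−2} for n = 6t+1 in the proof of Proposition B(b), showing that none of w_3 g_{n−2}, w_2 g_{n−1}, w_3 g_{n−2} + w_2 g_{n−1} is w_2-monomial.) -/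
open MvPolynomial

theorem coeff_g_aux (a b κ : ℕ) (h : κ = 2 * a + 3 * b) :
    coeff (Finsupp.single (0 : Fin 2) a + Finsupp.single (1 : Fin 2) b) (g κ)
      = (Nat.choose (a + b) a : ZMod 2) := by
  have key : ∀ c d : ℕ, (Xp ^ c * Yp ^ d : MvPolynomial (Fin 2) (ZMod 2))
      = monomial (Finsupp.single (0 : Fin 2) c + Finsupp.single (1 : Fin 2) d) 1 := by
    intro c d
    simp [Xp, Yp, X_pow_eq_monomial, monomial_mul]
  unfold g
  rw [coeff_sum, Finset.sum_eq_single (a + b)]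
  · rw [if_pos (by omega), key, coeff_smul, show 3 * (a + b) - κ = a by omega,
      show κ - 2 * (a + b) = b by omega, coeff_monomial, if_pos rfl]
    simp
  · intro i _ hi
    split_ifs with hc
    · rw [key, coeff_smul, coeff_monomial, if_neg, smul_zero]
      intro he
      have h0 := DFunLike.congr_fun he 0
      have h1 := DFunLike.congr_fun he 1
      simp at h0 h1
      omega
    · simp
  · intro hn
    exact absurd (Finset.mem_range.mpr (by omega)) hn

/-- The displayed computations for `n = 6t + 1` in the proof of Proposition B(b): the
coefficient of `X·Y^(2t)` in `X·g (6t)` is `1`, its coefficient in `Y·g (6t−1)` is `0`,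
the coefficient of `X^(3t+1)` in `X·g (6t)` is `1`, and hence the coefficient of
`X·Y^(2t)` in `X·g (6t) + Y·g (6t−1)` is `1`. -/
theorem coeffs_case_6t1 (t : ℕ) (ht : 1 ≤ t) :
    coeff ((Finsupp.single (0 : Fin 2) 1 + Finsupp.single (1 : Fin 2) (2 * t)))
        (Xp * g (6 * t)) = 1 ∧
    coeff ((Finsupp.single (0 : Fin 2) 1 + Finsupp.single (1 : Fin 2) (2 * t)))
        (Yp * g (6 * t - 1)) = 0 ∧
    coeff (Finsupp.single (0 : Fin 2) (3 * t + 1)) (Xp * g (6 * t)) = 1 ∧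
    coeff ((Finsupp.single (0 : Fin 2) 1 + Finsupp.single (1 : Fin 2) (2 * t)))
        (Xp * g (6 * t) + Yp * g (6 * t - 1)) = 1 := by
  have h1 : coeff ((Finsupp.single (0 : Fin 2) 1 + Finsupp.single (1 : Fin 2) (2 * t)))
      (Xp * g (6 * t)) = 1 := by
    have := coeff_g_aux 0 (2 * t) (6 * t) (by omega)
    rw [Xp, coeff_X_mul]
    simpa using this
  have h2 : coeff ((Finsupp.single (0 : Fin 2) 1 + Finsupp.single (1 : Fin 2) (2 * t)))
      (Yp * g (6 * t - 1)) = 0 := by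
    have := coeff_g_aux 1 (2 * t - 1) (6 * t - 1) (by omega)
    have e : Finsupp.single (0 : Fin 2) 1 + Finsupp.single (1 : Fin 2) (2 * t)
        = Finsupp.single (1 : Fin 2) 1
          + (Finsupp.single (0 : Fin 2) 1 + Finsupp.single (1 : Fin 2) (2 * t - 1)) := by
      rw [add_left_comm, ← Finsupp.single_add, show 1 + (2 * t - 1) = 2 * t by omega]
    rw [Yp, e, coeff_X_mul, this, show 1 + (2 * t - 1) = 2 * t by omega, Nat.choose_one_right]
    push_cast
    rw [show (2 : ZMod 2) = 0 from rfl, zero_mul]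
  refine ⟨h1, h2, ?_, ?_⟩
  · have := coeff_g_aux (3 * t) 0 (6 * t) (by omega)
    rw [Xp, add_comm (3 * t) 1, Finsupp.single_add, coeff_X_mul]
    simpa using this
  · rw [coeff_add, h1, h2, add_zero]
end

section
/- Let k = 3 and n ≥ 6, and let h be defined by the following cases: h = 2^s − 1 if n = 2^s + 1 with s ≥ 3; h = 2^s if n = 2^s + 2 with s ≥ 3; h = 2^s + 2^{p+1} − 2 if n = 2^s + 2^p + 1 with s > p ≥ 1; h = 2^s + 2^{p+1} − 1 if n = 2^s + 2^p + t + 1 with s > p ≥ 1 and 1 ≤ t ≤ 2^p − 1. Then the height of w_2 modulo I_{n,3} equals h, i.e. w_2^h ∉ I_{n,3} and w_2^{h+1} ∈ I_{n,3} in (ZMod 2)[w_1, w_2, w_3]. (Lemma F, the Dutta–Khare computation of ht(w_2(γ_{n,3})) in H*(G_{n,3}; Z2), translated via Borel's description of the cohomology ring.) -/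
open MvPolynomial

/-- Borel's ideal `I_{n,k}`: the ideal of `(ZMod 2)[w₁, …, w_k]` (with `w_i = X (i−1)` of
weight `i`) generated by the weighted-homogeneous components of weighted degrees
`n−k+1, …, n` of `Σ_{j=0}^{n} (w₁ + ⋯ + w_k)^j`, the formal inverse of `1 + w₁ + ⋯ + w_k`.
One has `(ZMod 2)[w₁, …, w_k]/I_{n,k} ≅ H*(G_{n,k}; Z₂)`. -/
noncomputable def borelIdeal (n k : ℕ) : Ideal (MvPolynomial (Fin k) (ZMod 2)) :=
  Ideal.span { p | ∃ d ∈ Finset.Icc (n - k + 1) n,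
    p = weightedHomogeneousComponent (fun i : Fin k => (i : ℕ) + 1) d
          (∑ j ∈ Finset.range (n + 1), (∑ i : Fin k, X i) ^ j) }

/-- weighted component shift -/
lemma comp_X_mul (i : Fin 3) (d : ℕ) (p : MvPolynomial (Fin 3) (ZMod 2)) :
    weightedHomogeneousComponent (fun i : Fin 3 => (i : ℕ) + 1) d (X i * p) =
      if (i : ℕ) + 1 ≤ d then
        X i * weightedHomogeneousComponent (fun i : Fin 3 => (i : ℕ) + 1) (d - (i + 1)) p
      else 0 := by
  classical
  ext m
  have key : ∀ (hm : i ∈ m.support),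
      Finsupp.weight (fun i : Fin 3 => (i : ℕ) + 1) m =
        Finsupp.weight (fun i : Fin 3 => (i : ℕ) + 1) (m - Finsupp.single i 1) + (i + 1) := by
    intro hm
    have h1 : m = (m - Finsupp.single i 1) + Finsupp.single i 1 := by
      rw [tsub_add_cancel_of_le]
      rw [Finsupp.single_le_iff]
      exact Nat.one_le_iff_ne_zero.mpr (Finsupp.mem_support_iff.mp hm)
    conv_lhs => rw [h1]
    rw [map_add]
    simp [Finsupp.weight_single]
  rw [coeff_weightedHomogeneousComponent, coeff_X_mul']
  by_cases hm : i ∈ m.support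
  · have := key hm
    split_ifs with h1 h2 h2
    · rw [coeff_X_mul', if_pos hm, coeff_weightedHomogeneousComponent, if_pos (by omega)]
    · omega
    · rw [coeff_X_mul', if_pos hm, coeff_weightedHomogeneousComponent, if_neg (by omega)]
    · simp
  · split_ifs with h1 h2 h2
    · rw [coeff_X_mul', if_neg hm]
    · simp
    · rw [coeff_X_mul', if_neg hm]
    · simp

/-- dual classes -/
noncomputable def gg : ℕ → MvPolynomial (Fin 3) (ZMod 2)
  | 0 => 1
  | 1 => X 0
  | 2 => X 0 ^ 2 + X 1
  | (d + 3) => X 0 * gg (d + 2) + X 1 * gg (d + 1) + X 2 * gg d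

lemma comp_sigma_mul (d : ℕ) (p : MvPolynomial (Fin 3) (ZMod 2)) :
    weightedHomogeneousComponent (fun i : Fin 3 => (i : ℕ) + 1) d ((∑ i : Fin 3, X i) * p) =
      (if 1 ≤ d then
        X 0 * weightedHomogeneousComponent (fun i : Fin 3 => (i : ℕ) + 1) (d - 1) p else 0) +
      (if 2 ≤ d then
        X 1 * weightedHomogeneousComponent (fun i : Fin 3 => (i : ℕ) + 1) (d - 2) p else 0) +
      (if 3 ≤ d then
        X 2 * weightedHomogeneousComponent (fun i : Fin 3 => (i : ℕ) + 1) (d - 3) p else 0) := by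
  rw [Finset.sum_mul, map_sum, Fin.sum_univ_three, comp_X_mul, comp_X_mul, comp_X_mul]
  rfl

lemma comp_sigma_pow (m : ℕ) : ∀ d, d < m →
    weightedHomogeneousComponent (fun i : Fin 3 => (i : ℕ) + 1) d
      ((∑ i : Fin 3, (X i : MvPolynomial (Fin 3) (ZMod 2))) ^ m) = 0 := by
  induction m with
  | zero => intro d hd; omega
  | succ m ih =>
    intro d hd
    rw [pow_succ', comp_sigma_mul]
    have hz : ∀ k, 1 ≤ k → k ≤ d → weightedHomogeneousComponent (fun i : Fin 3 => (i : ℕ) + 1)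
        (d - k) ((∑ i : Fin 3, (X i : MvPolynomial (Fin 3) (ZMod 2))) ^ m) = 0 :=
      fun k h1 h2 => ih (d - k) (by omega)
    have e : ∀ k, 1 ≤ k → ∀ i : Fin 3, (if k ≤ d then
        X i * weightedHomogeneousComponent (fun i : Fin 3 => (i : ℕ) + 1) (d - k)
          ((∑ i : Fin 3, (X i : MvPolynomial (Fin 3) (ZMod 2))) ^ m) else 0) = 0 := by
      intro k hk i
      split_ifs with h
      · rw [hz k hk h, mul_zero]
      · rfl
    rw [e 1 le_rfl, e 2 (by omega), e 3 (by omega)]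
    simp

lemma comp_one (d : ℕ) :
    weightedHomogeneousComponent (fun i : Fin 3 => (i : ℕ) + 1) d
      (1 : MvPolynomial (Fin 3) (ZMod 2)) = if d = 0 then 1 else 0 := by
  classical
  ext m
  rw [coeff_weightedHomogeneousComponent, coeff_one]
  by_cases hm : 0 = m
  · subst hm
    by_cases hd : d = 0
    · simp [hd]
    · simp [hd, Ne.symm hd]
  · split_ifs <;> simp [coeff_one, hm]

lemma comp_eq_gg (n : ℕ) : ∀ d, d ≤ n →
    weightedHomogeneousComponent (fun i : Fin 3 => (i : ℕ) + 1) d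
      (∑ j ∈ Finset.range (n + 1), (∑ i : Fin 3, (X i : MvPolynomial (Fin 3) (ZMod 2))) ^ j)
      = gg d := by
  set S := ∑ j ∈ Finset.range (n + 1), (∑ i : Fin 3, (X i : MvPolynomial (Fin 3) (ZMod 2))) ^ j
    with hS
  have hrec : (∑ i : Fin 3, (X i : MvPolynomial (Fin 3) (ZMod 2))) * S + 1 =
      S + (∑ i : Fin 3, (X i : MvPolynomial (Fin 3) (ZMod 2))) ^ (n + 1) := by
    rw [hS, ← Finset.sum_range_succ, Finset.mul_sum, Finset.sum_range_succ' _ (n + 1)]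
    simp only [pow_succ', pow_zero]
  have hc : ∀ d, d ≤ n → weightedHomogeneousComponent (fun i : Fin 3 => (i : ℕ) + 1) d S =
      weightedHomogeneousComponent (fun i : Fin 3 => (i : ℕ) + 1) d
        ((∑ i : Fin 3, X i) * S) + if d = 0 then 1 else 0 := by
    intro d hd
    have := congrArg (weightedHomogeneousComponent (fun i : Fin 3 => (i : ℕ) + 1) d) hrec
    rw [map_add, map_add, comp_sigma_pow (n + 1) d (by omega), comp_one, add_zero] at this
    exact this.symm
  intro d
  induction d using Nat.strong_induction_on with
  | _ d ih =>
    intro hd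
    rw [hc d hd, comp_sigma_mul]
    match d, ih, hd with
    | 0, ih, hd => simp [gg]
    | 1, ih, hd => simp [gg, ih 0 (by omega) (by omega)]
    | 2, ih, hd => 
      simp [gg, ih 0 (by omega) (by omega), ih 1 (by omega) (by omega)]; ring
    | d + 3, ih, hd =>
      simp [gg, ih d (by omega) (by omega), ih (d + 1) (by omega) (by omega),
        ih (d + 2) (by omega) (by omega)]

lemma borel_eq (d : ℕ) :
    borelIdeal (d + 2) 3 = Ideal.span {gg d, gg (d + 1), gg (d + 2)} ∨ d = 0 := by
  rcases Nat.eq_zero_or_pos d with h | h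
  · exact Or.inr h
  left
  unfold borelIdeal
  congr 1
  ext p
  simp only [Set.mem_ofPred_eq, Finset.mem_Icc, Set.mem_insert_iff, Set.mem_singleton_iff]
  constructor
  · rintro ⟨e, ⟨h1, h2⟩, rfl⟩
    rw [comp_eq_gg _ _ h2]
    have : e = d ∨ e = d + 1 ∨ e = d + 2 := by omega
    rcases this with rfl | rfl | rfl <;> simp
  · rintro (rfl | rfl | rfl)
    · exact ⟨d, by omega, (comp_eq_gg _ _ (by omega)).symm⟩
    · exact ⟨d + 1, by omega, (comp_eq_gg _ _ (by omega)).symm⟩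
    · exact ⟨d + 2, by omega, (comp_eq_gg _ _ (by omega)).symm⟩

section ring
variable {B : Type*} [CommRing B] [CharP B 2]

lemma gg_root (f : MvPolynomial (Fin 3) (ZMod 2) →+* B) (x y z : B)
    (h0 : f (X 0) = x + y + z) (h1 : f (X 1) = x * y + x * z + y * z)
    (h2 : f (X 2) = x * y * z) (d : ℕ) :
    x ^ (d + 2) = f (gg (d + 2)) + (y + z) * f (gg (d + 1)) + y * z * f (gg d) := by
  have two : (2 : B) = 0 := CharTwo.two_eq_zero
  induction d with
  | zero =>
    simp only [gg, map_add, map_pow, map_one, h0, h1]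
    linear_combination (-(x * y + x * z + y * z) * 2 - y^2 - z^2 - y * z) * two
  | succ d ih =>
    rw [pow_succ, ih]
    simp only [gg, map_add, map_mul, h0, h1, h2]
    linear_combination (-(y + z) * f (gg (d + 2)) - y * z * f (gg (d + 1))) * two

lemma gg_delta (f : MvPolynomial (Fin 3) (ZMod 2) →+* B) (x y z : B)
    (h0 : f (X 0) = x + y + z) (h1 : f (X 1) = x * y + x * z + y * z)
    (h2 : f (X 2) = x * y * z) (d : ℕ) :
    (x + y) * (x * y + x * z + y * z + z ^ 2) * f (gg d) =
      x ^ (d + 2) * (y + z) + y ^ (d + 2) * (x + z) + z ^ (d + 2) * (x + y) := by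
  have two : (2 : B) = 0 := CharTwo.two_eq_zero
  have hx := gg_root f x y z h0 h1 h2 d
  have hy := gg_root f y x z (by rw [h0]; ring) (by rw [h1]; ring) (by rw [h2]; ring) d
  have hz := gg_root f z x y (by rw [h0]; ring) (by rw [h1]; ring) (by rw [h2]; ring) d
  rw [hx, hy, hz]
  linear_combination (- (x + y + z) * f (gg (d + 2)) -
    (x^2+y^2+z^2+x*y+x*z+y*z) * f (gg (d + 1)) + x*y*z * f (gg d)) * two

/-- consequences of vanishing -/
lemma pair_rel (f : MvPolynomial (Fin 3) (ZMod 2) →+* B) (x y z : B)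
    (h0 : f (X 0) = x + y + z) (h1 : f (X 1) = x * y + x * z + y * z)
    (h2 : f (X 2) = x * y * z) (d : ℕ) 
    (g0 : f (gg (d + 2)) = 0) (g1 : f (gg (d + 3)) = 0) (g2 : f (gg (d + 4)) = 0) :
    x ^ (d + 4) = 0 ∧ x ^ (d + 3) * y ^ (d + 3) = 0 ∧ 
      x ^ (d + 3) * y ^ (d + 2) + x ^ (d + 2) * y ^ (d + 3) = 0 := by
  have two : (2 : B) = 0 := CharTwo.two_eq_zero
  have hx := gg_root f x y z h0 h1 h2
  have hy := gg_root f y x z (by rw [h0]; ring) (by rw [h1]; ring) (by rw [h2]; ring)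
  have x4 : x ^ (d + 4) = 0 := by rw [hx (d + 2), g0, g1, g2]; ring
  have y4 : y ^ (d + 4) = 0 := by rw [hy (d + 2), g0, g1, g2]; ring
  have e1 := hx (d + 1)
  have e2 := hx d
  have key : x ^ (d + 3) + y * x ^ (d + 2) + y ^ 2 * (f (gg (d + 1)) + z * f (gg d)) = 0 := by
    rw [e1, e2, g0, g1]
    linear_combination (y * (y + z) * f (gg (d + 1)) + y ^ 2 * z * f (gg d)) * two
  refine ⟨x4, ?_, ?_⟩
  · linear_combination y ^ (d + 3) * key - (x ^ (d + 2) + y * (f (gg (d + 1)) + z * f (gg d))) * y4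
  · linear_combination y ^ (d + 2) * key - ((f (gg (d + 1)) + z * f (gg d))) * y4
end ring
section lower
open scoped Polynomial in
lemma coeff_lin_pow {S : Type*} [CommRing S] (a b : S) (h k : ℕ) :
    ((Polynomial.C a + Polynomial.X * Polynomial.C b : S[X]) ^ h).coeff k = h.choose k * b ^ k * a ^ (h - k) := by
  have : (Polynomial.C a + Polynomial.X * Polynomial.C b : S[X]) ^ h =
      ∑ m ∈ Finset.range (h + 1), Polynomial.C ((h.choose m : S) * b ^ m * a ^ (h - m)) * Polynomial.X ^ m := by
    rw [add_comm, add_pow]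
    refine Finset.sum_congr rfl fun m _ => ?_
    simp only [map_mul, map_pow, map_natCast]
    ring
  rw [this, Polynomial.finsetSum_coeff]
  simp only [Polynomial.coeff_C_mul_X_pow]
  rw [Finset.sum_ite_eq]
  split_ifs with h1
  · rfl
  · rw [Finset.mem_range] at h1
    rw [Nat.choose_eq_zero_of_lt (by omega)]
    simp

open scoped Polynomial in
lemma coeff_two (r M u v : ℕ) (huv : u + v = M) :
    (((Polynomial.C Polynomial.X * Polynomial.X : (ZMod 2)[X][X]) ^ r * (Polynomial.C Polynomial.X + Polynomial.X) ^ M).coeff (r + v)).coeff (r + u)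
      = (M.choose v : ZMod 2) := by
  have : (Polynomial.C Polynomial.X * Polynomial.X : (ZMod 2)[X][X]) ^ r * (Polynomial.C Polynomial.X + Polynomial.X) ^ M =
      Polynomial.C (Polynomial.X ^ r) * ((Polynomial.X + Polynomial.C Polynomial.X) ^ M * Polynomial.X ^ r) := by
    rw [mul_pow, map_pow]; ring
  rw [this, Polynomial.coeff_C_mul, add_comm r v, Polynomial.coeff_mul_X_pow, Polynomial.coeff_X_add_C_pow, ← huv,
    Nat.add_sub_cancel]
  rw [← mul_assoc, ← pow_add, ← Polynomial.C_eq_natCast, Polynomial.coeff_mul_C, Polynomial.coeff_X_pow_self, one_mul]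

open scoped Polynomial in
lemma lower (d m r i j : ℕ) (hij : i + j = m + 1)
    (hi : r + i + 1 < d + 2) (hj : r + j + 1 < d + 2) (hk : m + 2 < d + 2)
    (hodd : (((m + r + 2).choose (m + 2) * (m + 3).choose (j + 1) +
      (m + r + 1).choose m * (m + 1).choose j : ℕ) : ZMod 2) ≠ 0) :
    (MvPolynomial.X 1 : MvPolynomial (Fin 3) (ZMod 2)) ^ (m + r + 1) ∉
      Ideal.span {gg d, gg (d + 1), gg (d + 2)} := by
  intro hmem
  set x : (ZMod 2)[X][X][X] := Polynomial.C (Polynomial.C Polynomial.X) with hx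
  set y : (ZMod 2)[X][X][X] := Polynomial.C Polynomial.X with hy
  set z : (ZMod 2)[X][X][X] := Polynomial.X with hz
  let f : MvPolynomial (Fin 3) (ZMod 2) →+* (ZMod 2)[X][X][X] :=
    (MvPolynomial.aeval ![x + y + z, x * y + x * z + y * z, x * y * z]).toRingHom
  have h0 : f (MvPolynomial.X 0) = x + y + z := by simp [f]
  have h1 : f (MvPolynomial.X 1) = x * y + x * z + y * z := by simp [f]
  have h2 : f (MvPolynomial.X 2) = x * y * z := by simp [f]
  have hD := gg_delta f x y z h0 h1 h2
  let J : Ideal (ZMod 2)[X][X][X] := Ideal.span {x ^ (d + 2), y ^ (d + 2), z ^ (d + 2)}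
  have hJ : ∀ e, d ≤ e → (x + y) * (x * y + x * z + y * z + z ^ 2) * f (gg e) ∈ J := by
    intro e he
    obtain ⟨e, rfl⟩ := Nat.exists_eq_add_of_le he
    rw [hD]
    have hgen : ∀ w ∈ ({x ^ (d + 2), y ^ (d + 2), z ^ (d + 2)} : Set (ZMod 2)[X][X][X]),
      w ∈ J := fun w hw => Ideal.subset_span hw
    have a1 := hgen (x ^ (d + 2)) (by simp)
    have a2 := hgen (y ^ (d + 2)) (by simp)
    have a3 := hgen (z ^ (d + 2)) (by simp)
    have : x ^ (d + e + 2) * (y + z) + y ^ (d + e + 2) * (x + z) + z ^ (d + e + 2) * (x + y) =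
      (x ^ e * (y + z)) * x ^ (d + 2) + (y ^ e * (x + z)) * y ^ (d + 2) +
        (z ^ e * (x + y)) * z ^ (d + 2) := by ring
    rw [this]
    exact J.add_mem (J.add_mem (J.mul_mem_left _ a1) (J.mul_mem_left _ a2)) (J.mul_mem_left _ a3)
  have hall : (x + y) * (x * y + x * z + y * z + z ^ 2) * f (MvPolynomial.X 1 ^ (m + r + 1))
      ∈ J := by
    rw [Ideal.mem_span_insert] at hmem
    obtain ⟨a, p, hp, hmem⟩ := hmem
    rw [Ideal.mem_span_pair] at hp
    obtain ⟨b, c, rfl⟩ := hp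
    rw [hmem]
    have : (x + y) * (x * y + x * z + y * z + z ^ 2) *
        f (a * gg d + (b * gg (d + 1) + c * gg (d + 2))) =
        f a * ((x + y) * (x * y + x * z + y * z + z ^ 2) * f (gg d)) +
        (f b * ((x + y) * (x * y + x * z + y * z + z ^ 2) * f (gg (d + 1))) +
        f c * ((x + y) * (x * y + x * z + y * z + z ^ 2) * f (gg (d + 2)))) := by
      simp only [map_add, map_mul]; ring
    rw [this]
    exact J.add_mem (J.mul_mem_left _ (hJ _ le_rfl))
      (J.add_mem (J.mul_mem_left _ (hJ _ (by omega))) (J.mul_mem_left _ (hJ _ (by omega))))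
  have hzero : ∀ q ∈ J, ((q.coeff (m + 2)).coeff (r + (j + 1))).coeff (r + (i + 1)) = 0 := by
    intro q hq
    rw [Ideal.mem_span_insert] at hq
    obtain ⟨a, p, hp, rfl⟩ := hq
    rw [Ideal.mem_span_pair] at hp
    obtain ⟨b, c, rfl⟩ := hp
    have e1 : a * x ^ (d + 2) = a * Polynomial.C (Polynomial.C (Polynomial.X ^ (d + 2))) := by simp [hx]
    have e2 : b * y ^ (d + 2) = b * Polynomial.C (Polynomial.X ^ (d + 2)) := by simp [hy]
    rw [e1, e2, hz]
    simp only [Polynomial.coeff_add, Polynomial.coeff_mul_C, Polynomial.coeff_mul_X_pow']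
    rw [if_neg (by omega), if_neg (by omega), if_neg (by omega)]
    simp
  apply hodd
  rw [← hzero _ hall, map_pow, h1]
  have e : (x + y) * (x * y + x * z + y * z + z ^ 2) * (x * y + x * z + y * z) ^ (m + r + 1) =
      Polynomial.C (Polynomial.C Polynomial.X + Polynomial.X) * ((Polynomial.C (Polynomial.C Polynomial.X * Polynomial.X) + Polynomial.X * Polynomial.C (Polynomial.C Polynomial.X + Polynomial.X)) ^ (m + r + 2) +
        (Polynomial.C (Polynomial.C Polynomial.X * Polynomial.X) + Polynomial.X * Polynomial.C (Polynomial.C Polynomial.X + Polynomial.X)) ^ (m + r + 1) * Polynomial.X ^ 2) := by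
    have : Polynomial.C (Polynomial.C Polynomial.X * Polynomial.X) + Polynomial.X * Polynomial.C (Polynomial.C Polynomial.X + Polynomial.X) = x * y + x * z + y * z := by
      simp only [map_mul, map_add, hx, hy, hz]; ring
    rw [this, map_add, ← hx, ← hy, ← hz]; ring
  rw [e, Polynomial.coeff_C_mul, Polynomial.coeff_add, Polynomial.coeff_mul_X_pow, coeff_lin_pow, coeff_lin_pow]
  have s1 : m + r + 2 - (m + 2) = r := by omega
  have s2 : m + r + 1 - m = r + 1 := by omega
  rw [s1, s2]
  have e' : (Polynomial.C Polynomial.X + Polynomial.X : (ZMod 2)[X][X]) * (((m + r + 2).choose (m + 2) : (ZMod 2)[X][X]) *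
        (Polynomial.C Polynomial.X + Polynomial.X) ^ (m + 2) * (Polynomial.C Polynomial.X * Polynomial.X) ^ r +
      ((m + r + 1).choose m : (ZMod 2)[X][X]) * (Polynomial.C Polynomial.X + Polynomial.X) ^ m * (Polynomial.C Polynomial.X * Polynomial.X) ^ (r + 1)) =
      Polynomial.C (Polynomial.C ((m + r + 2).choose (m + 2) : ZMod 2)) * ((Polynomial.C Polynomial.X * Polynomial.X) ^ r * (Polynomial.C Polynomial.X + Polynomial.X) ^ (m + 3)) +
      Polynomial.C (Polynomial.C ((m + r + 1).choose m : ZMod 2)) * ((Polynomial.C Polynomial.X * Polynomial.X) ^ (r + 1) * (Polynomial.C Polynomial.X + Polynomial.X) ^ (m + 1)) := by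
    simp only [map_natCast]
    ring
  rw [e']
  simp only [Polynomial.coeff_add, Polynomial.coeff_C_mul]
  rw [coeff_two r (m + 3) (i + 1) (j + 1) (by omega)]
  have := coeff_two (r + 1) (m + 1) i j hij
  rw [show r + 1 + j = r + (j + 1) by ring, show r + 1 + i = r + (i + 1) by ring] at this
  rw [this]
  push_cast
  ring
end lower

lemma choose_low (q : ℕ) : ∀ a b c : ℕ, b < 2 ^ q → c < 2 ^ q →
    (a * 2 ^ q + b).choose c ≡ b.choose c [MOD 2] := by
  induction q with
  | zero =>
    intro a b c hb hc
    have : c = 0 := by simpa using hc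
    subst this
    simp; rfl
  | succ q ih =>
    intro a b c hb hc
    have : Fact (Nat.Prime 2) := ⟨Nat.prime_two⟩
    have h1 := Choose.choose_modEq_choose_mod_mul_choose_div_nat (p := 2)
      (n := a * 2 ^ (q + 1) + b) (k := c)
    have h2 := Choose.choose_modEq_choose_mod_mul_choose_div_nat (p := 2) (n := b) (k := c)
    have e1 : (a * 2 ^ (q + 1) + b) % 2 = b % 2 := by
      rw [pow_succ, ← mul_assoc]; omega
    have e2 : (a * 2 ^ (q + 1) + b) / 2 = a * 2 ^ q + b / 2 := by
      rw [pow_succ, ← mul_assoc]; omega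
    rw [e1, e2] at h1
    rw [pow_succ] at hb hc
    exact h1.trans (((ih a (b / 2) (c / 2) (by omega) (by omega)).mul_left _).trans h2.symm)

lemma choose_full (q : ℕ) : ∀ c : ℕ, c < 2 ^ q → (2 ^ q - 1).choose c ≡ 1 [MOD 2] := by
  induction q with
  | zero =>
    intro c hc
    have : c = 0 := by simpa using hc
    subst this
    rfl
  | succ q ih =>
    intro c hc
    have : Fact (Nat.Prime 2) := ⟨Nat.prime_two⟩
    have h1 := Choose.choose_modEq_choose_mod_mul_choose_div_nat (p := 2)
      (n := 2 ^ (q + 1) - 1) (k := c)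
    have hq : 0 < 2 ^ q := by positivity
    have e1 : (2 ^ (q + 1) - 1) % 2 = 1 := by rw [pow_succ]; omega
    have e2 : (2 ^ (q + 1) - 1) / 2 = 2 ^ q - 1 := by rw [pow_succ]; omega
    have e3 : Nat.choose 1 (c % 2) = 1 := by
      rcases Nat.mod_two_eq_zero_or_one c with h | h <;> simp [h]
    rw [e1, e2, e3, one_mul] at h1
    rw [pow_succ] at hc
    exact h1.trans (ih _ (by omega))

lemma choose_even (p : ℕ) : (2 * 2 ^ (p + 1) + 1).choose (2 ^ (p + 1)) ≡ 0 [MOD 2] := by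
  have : Fact (Nat.Prime 2) := ⟨Nat.prime_two⟩
  have h1 := Choose.choose_modEq_choose_mod_mul_choose_div_nat (p := 2)
      (n := 2 * 2 ^ (p + 1) + 1) (k := 2 ^ (p + 1))
  have e2 : (2 * 2 ^ (p + 1) + 1) / 2 = 2 ^ (p + 1) := by omega
  have e3 : 2 ^ (p + 1) / 2 = 2 ^ p := by rw [pow_succ]; omega
  rw [e2, e3] at h1
  have : 2 ∣ (2 ^ (p + 1)).choose (2 ^ p) := by
    apply Nat.Prime.dvd_choose_pow Nat.prime_two
    · positivity
    · rw [pow_succ]; have : 0 < 2 ^ p := by positivity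
      omega
  exact h1.trans ((Nat.modEq_zero_iff_dvd).mpr (this.mul_left _))

/-- unified lower bound with `P = 2^(p+1)` -/
lemma lower' (d p r : ℕ) (hd : r + 2 ^ (p + 1) + 1 < d + 2) (hd' : 2 ^ (p + 2) < d + 2)
    (hr : (2 ^ (p + 2) - 1 + r).choose (2 ^ (p + 2) - 2) ≡ 1 [MOD 2]) :
    (MvPolynomial.X 1 : MvPolynomial (Fin 3) (ZMod 2)) ^ (2 ^ (p + 2) - 1 + r) ∉
      Ideal.span {gg d, gg (d + 1), gg (d + 2)} := by
  have hP : 2 ≤ 2 ^ (p + 1) := by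
    rw [pow_succ]; have : 0 < 2 ^ p := by positivity
    omega
  have hQ : 2 ^ (p + 2) = 2 * 2 ^ (p + 1) := by ring
  have := lower d (2 ^ (p + 2) - 2) r (2 ^ (p + 1)) (2 ^ (p + 1) - 1) (by omega) (by omega)
    (by omega) (by omega) ?_
  · rwa [show 2 ^ (p + 2) - 2 + r + 1 = 2 ^ (p + 2) - 1 + r by omega] at this
  · have c1 := choose_even p
    have c2 := choose_full (p + 2) (2 ^ (p + 1) - 1) (by omega)
    rw [show 2 ^ (p + 2) - 2 + 3 = 2 * 2 ^ (p + 1) + 1 by omega,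
      show 2 ^ (p + 1) - 1 + 1 = 2 ^ (p + 1) by omega,
      show 2 ^ (p + 2) - 2 + r + 1 = 2 ^ (p + 2) - 1 + r by omega,
      show 2 ^ (p + 2) - 2 + 1 = 2 ^ (p + 2) - 1 by omega]
    rw [← ZMod.natCast_eq_natCast_iff] at c1 c2 hr
    rw [Nat.cast_add, Nat.cast_mul, Nat.cast_mul, c1, c2, hr]
    simp
section upper
variable {B : Type*} [CommRing B] [CharP B 2]

lemma e2_pow (x y z : B) (s : ℕ) : (x * y + x * z + y * z) ^ (2 ^ s) =
    x ^ (2 ^ s) * y ^ (2 ^ s) + x ^ (2 ^ s) * z ^ (2 ^ s) + y ^ (2 ^ s) * z ^ (2 ^ s) := by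
  rw [add_pow_char_pow, add_pow_char_pow, mul_pow, mul_pow, mul_pow]

lemma up4 (x y z : B) (s q : ℕ) (hx : x ^ (2 ^ s + 2 ^ q) = 0) (hy : y ^ (2 ^ s + 2 ^ q) = 0)
    (hz : z ^ (2 ^ s + 2 ^ q) = 0) : (x * y + x * z + y * z) ^ (2 ^ s + 2 ^ q) = 0 := by
  rw [pow_add] at hx hy hz
  rw [pow_add, e2_pow, e2_pow]
  generalize x ^ 2 ^ s = X1 at *
  generalize y ^ 2 ^ s = X2 at *
  generalize z ^ 2 ^ s = X3 at *
  generalize x ^ 2 ^ q = Y1 at *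
  generalize y ^ 2 ^ q = Y2 at *
  generalize z ^ 2 ^ q = Y3 at *
  linear_combination (X2 * Y2 + X2 * Y3 + X3 * Y2 + X3 * Y3) * hx +
    (X1 * Y3 + X3 * Y1 + X3 * Y3) * hy + (X1 * Y2 + X2 * Y1) * hz

/-- one pair: `N = 2^s`, `P = 2^p`, `n = N + P + 1`. -/
lemma up3_pair (x y z : B) (N p : ℕ) (hx : x ^ (N + 2 ^ p + 1) = 0) (hy : y ^ (N + 2 ^ p + 1) = 0)
    (h1 : x ^ (N + 2 ^ p) * y ^ (N + 2 ^ p) = 0)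
    (h2 : x ^ (N + 2 ^ p) * y ^ (N + 2 ^ p - 1) + x ^ (N + 2 ^ p - 1) * y ^ (N + 2 ^ p) = 0) :
    x ^ N * y ^ N * (x * y + x * z + y * z) ^ (2 ^ p + (2 ^ p - 1)) = 0 := by
  have hP : 0 < 2 ^ p := by positivity
  rw [Nat.add_sub_assoc hP] at h2
  rw [pow_add _ (2 ^ p), e2_pow]
  generalize 2 ^ p - 1 = m at *
  generalize 2 ^ p = P at *
  obtain ⟨u, hu⟩ : (x * (y + z)) ∣ (x * y + x * z + y * z) ^ m - (y * z) ^ m := by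
    have := sub_dvd_pow_sub_pow (x * y + x * z + y * z) (y * z) m
    rwa [show x * y + x * z + y * z - y * z = x * (y + z) by ring] at this
  obtain ⟨v, hv⟩ : (y * (x + z)) ∣ (x * y + x * z + y * z) ^ m - (x * z) ^ m := by
    have := sub_dvd_pow_sub_pow (x * y + x * z + y * z) (x * z) m
    rwa [show x * y + x * z + y * z - x * z = y * (x + z) by ring] at this
  rw [mul_pow] at hu hv
  rw [pow_add] at hx hy
  rw [pow_add x N P] at hx h1
  rw [pow_add y N P] at hy h1
  simp only [pow_add] at h2
  rw [pow_one] at hx hy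
  generalize (x * y + x * z + y * z) ^ m = E at *
  linear_combination E * h1 + x ^ N * y ^ N * x ^ P * z ^ P * hu + x ^ N * y ^ N * y ^ P * z ^ P * hv
    + y ^ N * z ^ P * (y + z) * u * hx + x ^ N * z ^ P * (x + z) * v * hy
    + z ^ P * z ^ m * h2

end upper

/-- transfer of membership -/
lemma upper_transfer (d h : ℕ)
    (H : ∀ (B : Type) [CommRing B] [CharP B 2] (x y z : B),
      (∀ a b, (a = x ∧ b = y) ∨ (a = x ∧ b = z) ∨ (a = y ∧ b = z) ∨ (a = z ∧ b = y) →
        a ^ (d + 4) = 0 ∧ a ^ (d + 3) * b ^ (d + 3) = 0 ∧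
        a ^ (d + 3) * b ^ (d + 2) + a ^ (d + 2) * b ^ (d + 3) = 0) →
      (x * y + x * z + y * z) ^ h = 0) :
    (X 1 : MvPolynomial (Fin 3) (ZMod 2)) ^ h ∈
      Ideal.span {gg (d + 2), gg (d + 3), gg (d + 4)} := by
  set I : Ideal (MvPolynomial (Fin 3) (ZMod 2)) :=
    Ideal.span {gg (d + 2), gg (d + 3), gg (d + 4)} with hI
  by_cases htop : I = ⊤
  · rw [htop]; trivial
  have : Nontrivial (MvPolynomial (Fin 3) (ZMod 2) ⧸ I) := Ideal.Quotient.nontrivial_iff.mpr htop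
  let π := Ideal.Quotient.mk I
  let c : Polynomial (MvPolynomial (Fin 3) (ZMod 2) ⧸ I) :=
    Polynomial.X ^ 3 + (Polynomial.C (π (X 0)) * Polynomial.X ^ 2 +
      Polynomial.C (π (X 1)) * Polynomial.X + Polynomial.C (π (X 2)))
  have hdeg : (Polynomial.C (π (X 0)) * Polynomial.X ^ 2 +
      Polynomial.C (π (X 1)) * Polynomial.X + Polynomial.C (π (X 2))).degree < ((3 : ℕ) : WithBot ℕ) :=
    lt_of_le_of_lt Polynomial.degree_quadratic_le (by norm_num)
  have hc : c.Monic := Polynomial.monic_X_pow_add hdeg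
  have hcd : c.natDegree = 3 := by
    apply Polynomial.natDegree_eq_of_degree_eq_some
    rw [Polynomial.degree_add_eq_left_of_degree_lt] <;> rw [Polynomial.degree_X_pow]
    exact hdeg
  obtain ⟨S, _, _, _, _, _, hS⟩ := hc.exists_splits_map
  have hinj : Function.Injective (algebraMap (MvPolynomial (Fin 3) (ZMod 2) ⧸ I) S) :=
    FaithfulSMul.algebraMap_injective _ _
  obtain ⟨ms, hms⟩ := Polynomial.splits_iff_exists_multiset'.mp hS
  rw [(hc.map _).leadingCoeff, map_one, one_mul] at hms
  have hcard : ms.card = 3 := by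
    have := congrArg Polynomial.natDegree hms
    rw [hc.natDegree_map, hcd, Polynomial.natDegree_multiset_prod_of_monic] at this
    · simpa using this.symm
    · intro q hq
      obtain ⟨a, _, rfl⟩ := Multiset.mem_map.mp hq
      exact Polynomial.monic_X_add_C a
  obtain ⟨x, y, z, rfl⟩ := Multiset.card_eq_three.mp hcard
  let f : MvPolynomial (Fin 3) (ZMod 2) →+* S := (algebraMap _ S).comp π
  have hchar : CharP S 2 := charP_of_injective_ringHom (f := f.comp (C : ZMod 2 →+* _))
    (RingHom.injective _) 2
  have hexp : (Polynomial.X ^ 3 + (Polynomial.C (f (X 0)) * Polynomial.X ^ 2 +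
      Polynomial.C (f (X 1)) * Polynomial.X + Polynomial.C (f (X 2))) : Polynomial S) =
      Polynomial.X ^ 3 + (Polynomial.C (x + y + z) * Polynomial.X ^ 2 +
      Polynomial.C (x * y + x * z + y * z) * Polynomial.X + Polynomial.C (x * y * z)) := by
    have : (Polynomial.X ^ 3 + (Polynomial.C (f (X 0)) * Polynomial.X ^ 2 +
      Polynomial.C (f (X 1)) * Polynomial.X + Polynomial.C (f (X 2))) : Polynomial S) =
        c.map (algebraMap _ S) := by
      simp [c, f]
    rw [this, hms]
    simp
    ring
  have h0 : f (X 0) = x + y + z := by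
    have := congrArg (fun q => Polynomial.coeff q 2) hexp
    simpa [-map_add, -map_mul, Polynomial.coeff_X, Polynomial.coeff_C, Polynomial.coeff_X_pow] using this
  have h1 : f (X 1) = x * y + x * z + y * z := by
    have := congrArg (fun q => Polynomial.coeff q 1) hexp
    simpa [-map_add, -map_mul, Polynomial.coeff_X, Polynomial.coeff_C, Polynomial.coeff_X_pow] using this
  have h2 : f (X 2) = x * y * z := by
    have := congrArg (fun q => Polynomial.coeff q 0) hexp
    simpa [-map_add, -map_mul, Polynomial.coeff_X, Polynomial.coeff_C, Polynomial.coeff_X_pow] using this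
  have hker : ∀ g ∈ ({gg (d + 2), gg (d + 3), gg (d + 4)} : Set _), f g = 0 := by
    intro g hg
    have : π g = 0 := Ideal.Quotient.eq_zero_iff_mem.mpr (Ideal.subset_span hg)
    simp [f, this]
  have g0 := hker (gg (d + 2)) (by simp)
  have g1 := hker (gg (d + 3)) (by simp)
  have g2 := hker (gg (d + 4)) (by simp)
  have hfin := H S x y z (by
    rintro a b (⟨rfl, rfl⟩ | ⟨rfl, rfl⟩ | ⟨rfl, rfl⟩ | ⟨rfl, rfl⟩)
    · exact pair_rel f a b z h0 h1 h2 d g0 g1 g2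
    · exact pair_rel f a b y (by rw [h0]; ring) (by rw [h1]; ring) (by rw [h2]; ring) d g0 g1 g2
    · exact pair_rel f a b x (by rw [h0]; ring) (by rw [h1]; ring) (by rw [h2]; ring) d g0 g1 g2
    · exact pair_rel f a b x (by rw [h0]; ring) (by rw [h1]; ring) (by rw [h2]; ring) d g0 g1 g2)
  rw [← h1, ← map_pow] at hfin
  apply Ideal.Quotient.eq_zero_iff_mem.mp
  apply hinj
  rw [map_zero]
  exact hfin

lemma upper1 (s d : ℕ) (hd : d + 4 = 2 ^ s + 1) :
    (X 1 : MvPolynomial (Fin 3) (ZMod 2)) ^ (2 ^ s) ∈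
      Ideal.span {gg (d + 2), gg (d + 3), gg (d + 4)} := by
  apply upper_transfer
  intro B _ _ x y z H
  rw [e2_pow, ← show d + 3 = 2 ^ s by omega, (H x y (by simp)).2.1, (H x z (by simp)).2.1,
    (H y z (by simp)).2.1]
  simp

lemma upper3 (s p d : ℕ) (hd : d + 4 = 2 ^ s + 2 ^ p + 1) :
    (X 1 : MvPolynomial (Fin 3) (ZMod 2)) ^ (2 ^ s + (2 ^ p + (2 ^ p - 1))) ∈
      Ideal.span {gg (d + 2), gg (d + 3), gg (d + 4)} := by
  apply upper_transfer
  intro B _ _ x y z H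
  have e4 := hd
  have e3 : d + 3 = 2 ^ s + 2 ^ p := by omega
  have e2 : d + 2 = 2 ^ s + 2 ^ p - 1 := by omega
  rw [e4, e3, e2] at H
  have hxy := H x y (by simp)
  have hxz := H x z (by simp)
  have hyz := H y z (by simp)
  have hzy := H z y (by simp)
  have a1 := up3_pair x y z (2 ^ s) p hxy.1 hyz.1 hxy.2.1 hxy.2.2
  have a2 := up3_pair x z y (2 ^ s) p hxy.1 hzy.1 hxz.2.1 hxz.2.2
  have a3 := up3_pair y z x (2 ^ s) p hyz.1 hzy.1 hyz.2.1 hyz.2.2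
  rw [show x * z + x * y + z * y = x * y + x * z + y * z by ring] at a2
  rw [show y * z + y * x + z * x = x * y + x * z + y * z by ring] at a3
  rw [pow_add _ (2 ^ s), e2_pow, add_mul, add_mul, a1, a2, a3]
  simp

lemma upper4 (s q d : ℕ) (hd : d + 4 ≤ 2 ^ s + 2 ^ q) :
    (X 1 : MvPolynomial (Fin 3) (ZMod 2)) ^ (2 ^ s + 2 ^ q) ∈
      Ideal.span {gg (d + 2), gg (d + 3), gg (d + 4)} := by
  apply upper_transfer
  intro B _ _ x y z H
  exact up4 x y z s q (pow_eq_zero_of_le hd (H x y (by simp)).1)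
    (pow_eq_zero_of_le hd (H y z (by simp)).1) (pow_eq_zero_of_le hd (H z y (by simp)).1)
/-- Lemma F (Dutta–Khare) for `k = 3`: the height of `w₂` in
`H*(G_{n,3}; Z₂) = (ZMod 2)[w₁,w₂,w₃]/I_{n,3}` is `2^s − 1` if `n = 2^s + 1` (`s ≥ 3`),
`2^s` if `n = 2^s + 2` (`s ≥ 3`), `2^s + 2^(p+1) − 2` if `n = 2^s + 2^p + 1`
(`s > p ≥ 1`), and `2^s + 2^(p+1) − 1` if `n = 2^s + 2^p + t + 1` (`s > p ≥ 1`,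
`1 ≤ t ≤ 2^p − 1`). -/
theorem height_w2_G_n_3 (n h : ℕ) (hn : 6 ≤ n)
    (hcase :
      (∃ s, 3 ≤ s ∧ n = 2 ^ s + 1 ∧ h = 2 ^ s - 1) ∨
      (∃ s, 3 ≤ s ∧ n = 2 ^ s + 2 ∧ h = 2 ^ s) ∨
      (∃ s p, p < s ∧ 1 ≤ p ∧ n = 2 ^ s + 2 ^ p + 1 ∧ h = 2 ^ s + 2 ^ (p + 1) - 2) ∨
      (∃ s p t, p < s ∧ 1 ≤ p ∧ 1 ≤ t ∧ t ≤ 2 ^ p - 1 ∧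
        n = 2 ^ s + 2 ^ p + t + 1 ∧ h = 2 ^ s + 2 ^ (p + 1) - 1)) :
    (X 1 : MvPolynomial (Fin 3) (ZMod 2)) ^ h ∉ borelIdeal n 3 ∧
    (X 1 : MvPolynomial (Fin 3) (ZMod 2)) ^ (h + 1) ∈ borelIdeal n 3 := by
  obtain ⟨d, rfl⟩ : ∃ d, n = d + 4 := ⟨n - 4, by omega⟩
  have hI : borelIdeal (d + 4) 3 = Ideal.span {gg (d + 2), gg (d + 3), gg (d + 4)} := by
    rcases borel_eq (d + 2) with h | h
    · exact h
    · omega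
  rw [hI]
  rcases hcase with ⟨s, hs, hn', rfl⟩ | ⟨s, hs, hn', rfl⟩ | ⟨s, p, hps, hp, hn', rfl⟩ |
    ⟨s, p, t, hps, hp, ht, ht', hn', rfl⟩
  · obtain ⟨p, rfl⟩ : ∃ p, s = p + 2 := ⟨s - 2, by omega⟩
    have hQ : 2 ^ (p + 2) = 2 * 2 ^ (p + 1) := by ring
    have hP : 2 ≤ 2 ^ (p + 1) := by
      rw [pow_succ]; have : 0 < 2 ^ p := by positivity
      omega
    constructor
    · have := lower' (d + 2) p 0 (by omega) (by omega)
        (by rw [add_zero]; exact choose_full (p + 2) _ (by omega))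
      rwa [add_zero] at this
    · rw [show 2 ^ (p + 2) - 1 + 1 = 2 ^ (p + 2) by omega]
      exact upper1 _ _ hn'
  · have h4 : 8 ≤ 2 ^ s := by
      calc 8 = 2 ^ 3 := by norm_num
        _ ≤ 2 ^ s := Nat.pow_le_pow_right (by norm_num) hs
    constructor
    · have := lower (d + 2) 0 (2 ^ s - 1) 1 0 (by omega) (by omega) (by omega) (by omega) ?_
      · rwa [show 0 + (2 ^ s - 1) + 1 = 2 ^ s by omega] at this
      · rw [show 0 + (2 ^ s - 1) + 2 = 1 * 2 ^ s + 1 by omega]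
        have c := choose_low s 1 1 2 (by omega) (by omega)
        rw [← ZMod.natCast_eq_natCast_iff] at c
        rw [Nat.cast_add, Nat.cast_mul, Nat.cast_mul, zero_add, c]
        simp
    · exact upper3 s 0 d (by rw [hn']; rfl)
  · obtain ⟨p, rfl⟩ : ∃ q, p = q + 1 := ⟨p - 1, by omega⟩
    obtain ⟨r, rfl⟩ : ∃ r, s = r + (p + 2) := ⟨s - (p + 2), by omega⟩
    have hQ : 2 ^ (p + 2) = 2 * 2 ^ (p + 1) := by ring
    have hQ' : 2 ^ (p + 1 + 1) = 2 * 2 ^ (p + 1) := by ring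
    have hP : 2 ≤ 2 ^ (p + 1) := by
      rw [pow_succ]; have : 0 < 2 ^ p := by positivity
      omega
    have hN : 2 ^ (p + 2) ≤ 2 ^ (r + (p + 2)) := Nat.pow_le_pow_right (by norm_num) (by omega)
    constructor
    · have := lower' (d + 2) p (2 ^ (r + (p + 2)) - 1) (by omega) (by omega) (by
        rw [show 2 ^ (p + 2) - 1 + (2 ^ (r + (p + 2)) - 1) =
          2 ^ r * 2 ^ (p + 2) + (2 ^ (p + 2) - 2) by rw [← pow_add]; omega]
        refine (choose_low (p + 2) _ _ _ (by omega) (by omega)).trans ?_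
        rw [Nat.choose_self])
      rwa [show 2 ^ (p + 2) - 1 + (2 ^ (r + (p + 2)) - 1) =
        2 ^ (r + (p + 2)) + 2 ^ (p + 1 + 1) - 2 by omega] at this
    · rw [show 2 ^ (r + (p + 2)) + 2 ^ (p + 1 + 1) - 2 + 1 =
        2 ^ (r + (p + 2)) + (2 ^ (p + 1) + (2 ^ (p + 1) - 1)) by omega]
      exact upper3 _ _ _ hn'
  · obtain ⟨p, rfl⟩ : ∃ q, p = q + 1 := ⟨p - 1, by omega⟩
    obtain ⟨r, rfl⟩ : ∃ r, s = r + (p + 2) := ⟨s - (p + 2), by omega⟩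
    have hQ : 2 ^ (p + 2) = 2 * 2 ^ (p + 1) := by ring
    have hQ' : 2 ^ (p + 1 + 1) = 2 * 2 ^ (p + 1) := by ring
    have hP : 2 ≤ 2 ^ (p + 1) := by
      rw [pow_succ]; have : 0 < 2 ^ p := by positivity
      omega
    have hN : 2 ^ (p + 2) ≤ 2 ^ (r + (p + 2)) := Nat.pow_le_pow_right (by norm_num) (by omega)
    constructor
    · have := lower' (d + 2) p (2 ^ (r + (p + 2))) (by omega) (by omega) (by
        rw [show 2 ^ (p + 2) - 1 + (2 ^ (r + (p + 2))) =
          2 ^ r * 2 ^ (p + 2) + (2 ^ (p + 2) - 1) by rw [← pow_add]; omega]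
        refine (choose_low (p + 2) _ _ _ (by omega) (by omega)).trans ?_
        exact choose_full (p + 2) _ (by omega))
      rwa [show 2 ^ (p + 2) - 1 + (2 ^ (r + (p + 2))) =
        2 ^ (r + (p + 2)) + 2 ^ (p + 1 + 1) - 1 by omega] at this
    · rw [show 2 ^ (r + (p + 2)) + 2 ^ (p + 1 + 1) - 1 + 1 =
        2 ^ (r + (p + 2)) + 2 ^ (p + 2) by omega]
      exact upper4 _ _ _ (by omega)
end
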